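/- arXiv:1808.07107 — 4 statements merged into one kernel-verified Lean document; each statement's English description precedes it below -/
import Mathlib

section
/- Fix d ≥ 1 and for n ≥ 1 write P_n : ℝ^d → ℝ^d, P_n(v) = v/√n (coordinatewise). Let μ_n be Borel probability measures supported on ℕ^d such that the pushforwards μ_n ∘ P_n^{-1} converge weakly to a Borel probability measure μ on [0,∞)^d. Let R_n : ℕ^d → 𝒫(ℕ^d) (n ≥ 1) be arbitrary maps and let R : [0,∞)^d → 𝒫([0,∞)^d) be continuous when 𝒫 carries the topology of weak convergence, such that: whenever v_n ∈ ℕ^d satisfy v_n/√n → u ∈ [0,∞)^d, the measures R_n(v_n) ∘ P_n^{-1} converge weakly to R(u). Define the mixture measures R̃_n(μ_n)(A) := ∫_{ℕ^d} R_n(v)(A) μ_n(dv) and R̃(μ)(B) := ∫_{[0,∞)^d} R(u)(B) μ(du). Then R̃_n(μ_n) ∘ P_n^{-1} converges weakly to R̃(μ). -/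
open Filter MeasureTheory

/-- Weak convergence of a sequence of (finite Borel) measures: integrals of
bounded continuous functions converge. -/
def WeakConv {E : Type*} [MeasurableSpace E] [TopologicalSpace E]
    (μs : ℕ → Measure E) (μ : Measure E) : Prop :=
  ∀ φ : BoundedContinuousFunction E ℝ,
    Tendsto (fun n => ∫ x, φ x ∂(μs n)) atTop (nhds (∫ x, φ x ∂μ))

open ProbabilityTheory in
lemma aux_integral_bind {α β : Type*} [MeasurableSpace α] [MeasurableSpace β] (μ : Measure α)
    [IsProbabilityMeasure μ] (κ : α → Measure β) (hκ : Measurable κ)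
    (hp : ∀ a, IsProbabilityMeasure (κ a)) (f : β → ℝ) (hf : Measurable f) (C : ℝ)
    (hC : ∀ x, ‖f x‖ ≤ C) :
    ∫ x, f x ∂(μ.bind κ) = ∫ a, ∫ x, f x ∂(κ a) ∂μ := by
  let K : Kernel α β := ⟨κ, hκ⟩
  have : IsMarkovKernel K := ⟨hp⟩
  have hi : Integrable f ((K ∘ₖ (Kernel.const Unit μ)) ()) := by
    exact Integrable.of_bound hf.aestronglyMeasurable C (Eventually.of_forall hC)
  have h := Kernel.integral_comp hi
  rw [Kernel.comp_apply, Kernel.const_apply] at h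
  exact h

lemma aux_measurable {E : Type*} [TopologicalSpace E] [MeasurableSpace E] [BorelSpace E]
    [HasOuterApproxClosed E] (R : E → Measure E) (hR : ∀ u, IsProbabilityMeasure (R u))
    (hc : ∀ φ : BoundedContinuousFunction E ℝ, Continuous fun u => ∫ x, φ x ∂(R u)) :
    Measurable R := by
  let ν : E → ProbabilityMeasure E := fun u => ⟨R u, hR u⟩
  have hc' : Continuous ν :=
    ProbabilityMeasure.continuous_iff_forall_continuous_integral.2 hc
  refine Measurable.measure_of_isPiSystem_of_isProbabilityMeasure
    (S := {s | IsClosed s}) ?_ isPiSystem_isClosed ?_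
  · rw [BorelSpace.measurable_eq (α := E), borel_eq_generateFrom_isClosed]
  · intro F hF
    have hF : IsClosed F := hF
    refine measurable_of_tendsto_metrizable
      (f := fun n u => ∫⁻ x, hF.apprSeq n x ∂(R u)) (fun n => ?_) ?_
    · exact (ProbabilityMeasure.continuous_iff_forall_continuous_lintegral.1 hc'
        (hF.apprSeq n)).measurable
    · exact tendsto_pi_nhds.2 fun u => HasOuterApproxClosed.tendsto_lintegral_apprSeq hF (R u)

/-- Filling a subsequence. -/
lemma aux_extend {V X : Type*} [TopologicalSpace X] (P : ℕ → V → X) (u : X)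
    (f : ℕ → V) (hf : Tendsto (fun n => P n (f n)) atTop (nhds u))
    (m : ℕ → ℕ) (hm : StrictMono m) (v : ℕ → V)
    (hv : Tendsto (fun k => P (m k) (v k)) atTop (nhds u)) :
    Tendsto (fun n => P n (Function.extend m v f n)) atTop (nhds u) := by
  intro U hU
  have h1 := hf hU
  have h2 := hv hU
  rw [mem_map, mem_atTop_sets] at *
  obtain ⟨a, ha⟩ := h1
  obtain ⟨b, hb⟩ := h2
  refine ⟨max a (m b), fun n hn => ?_⟩
  by_cases h : ∃ k, m k = n
  · obtain ⟨k, rfl⟩ := h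
    have : b ≤ k := hm.le_iff_le.1 ((le_max_right _ _).trans hn)
    simpa [hm.injective.extend_apply] using hb k this
  · simpa [Function.extend_apply' _ _ _ h] using ha n ((le_max_left _ _).trans hn)

lemma aux_local {V X : Type*} [TopologicalSpace X] [FirstCountableTopology X]
    (P : ℕ → V → X) (u : X)
    (f : ℕ → V) (hf : Tendsto (fun n => P n (f n)) atTop (nhds u))
    (g : ℕ → V → ℝ) (c : ℝ)
    (h : ∀ vs : ℕ → V, Tendsto (fun n => P n (vs n)) atTop (nhds u) →
      Tendsto (fun n => g n (vs n)) atTop (nhds c)) :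
    Tendsto (fun p : ℕ × V => g p.1 p.2)
      (comap (fun p : ℕ × V => p.1) atTop ⊓ comap (fun p : ℕ × V => P p.1 p.2) (nhds u))
      (nhds c) := by
  refine tendsto_of_subseq_tendsto fun ns hns => ?_
  obtain ⟨h1, h2⟩ := tendsto_inf.1 hns
  rw [tendsto_comap_iff] at h1 h2
  obtain ⟨φ, hφ, hm⟩ := strictMono_subseq_of_tendsto_atTop h1
  refine ⟨φ, ?_⟩
  have := h _ (aux_extend P u f hf _ hm (fun k => (ns (φ k)).2) (h2.comp hφ.tendsto_atTop))
  have := this.comp hm.tendsto_atTop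
  refine this.congr fun k => ?_
  simp only [Function.comp_apply]
  have := hm.injective.extend_apply (fun k => (ns (φ k)).2) f k
  simp only [Function.comp_apply] at this
  rw [this]

lemma aux_compact {V X : Type*} [TopologicalSpace X] (P : ℕ → V → X) (K : Set X)
    (hK : IsCompact K) (D : ℕ → V → ℝ)
    (h : ∀ u ∈ K, Tendsto (fun p : ℕ × V => D p.1 p.2)
      (comap (fun p : ℕ × V => p.1) atTop ⊓ comap (fun p : ℕ × V => P p.1 p.2) (nhds u))
      (nhds 0)) (ε : ℝ) (hε : 0 < ε) :
    ∀ᶠ n in atTop, ∀ v, P n v ∈ K → |D n v| < ε := by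
  refine hK.induction_on (p := fun s => ∀ᶠ n in atTop, ∀ v, P n v ∈ s → |D n v| < ε) ?_ ?_ ?_ ?_
  · simp
  · intro s t hst ht
    filter_upwards [ht] with n hn v hv using hn v (hst hv)
  · intro s t hs ht
    filter_upwards [hs, ht] with n h1 h2 v hv using hv.elim (h1 v) (h2 v)
  · intro u hu
    have := (h u hu).eventually (Metric.ball_mem_nhds 0 hε)
    rw [eventually_inf] at this
    obtain ⟨s, hs, t, ht, hst⟩ := this
    obtain ⟨s', hs', hss⟩ := hs
    obtain ⟨t', ht', htt⟩ := ht
    refine ⟨t', mem_nhdsWithin_of_mem_nhds ht', ?_⟩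
    filter_upwards [hs'] with n hn v hv
    simpa using hst (n, v) ⟨hss hn, htt hv⟩

lemma aux_tight {d : ℕ} (μ : Measure (Fin d → ℝ)) [IsProbabilityMeasure μ] :
    Tendsto (fun M : ℕ => ∫ u, min 1 (max 0 (‖u‖ - M)) ∂μ) atTop (nhds 0) := by
  have : Tendsto (fun M : ℕ => ∫ u, min 1 (max 0 (‖u‖ - M)) ∂μ) atTop
      (nhds (∫ u : Fin d → ℝ, (0 : ℝ) ∂μ)) := by
    refine tendsto_integral_of_dominated_convergence (fun _ => 1) (fun n => ?_)
      (integrable_const _) (fun n => ?_) ?_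
    · exact Continuous.aestronglyMeasurable (by fun_prop)
    · refine Eventually.of_forall fun u => ?_
      rw [Real.norm_eq_abs, abs_of_nonneg (by positivity)]
      exact min_le_left _ _
    · refine Eventually.of_forall fun u => ?_
      refine tendsto_const_nhds.congr' ?_
      obtain ⟨N, hN⟩ := exists_nat_ge ‖u‖
      filter_upwards [eventually_ge_atTop N] with n hn
      have : (N : ℝ) ≤ n := by exact_mod_cast hn
      rw [max_eq_left (by linarith)]
      simp
  simpa using this

/-- Convergence of the mixtures of the regenerative measures:
if `μₙ ∘ Pₙ⁻¹ ⇒ μ` (with `Pₙ(v) = v/√n`), the kernels `Rₙ` on the lattice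
`ℕ^d` converge to the weakly-continuous kernel `R` on `[0,∞)^d` along
`Pₙ`-convergent sequences, then the mixture measures satisfy
`R̃ₙ(μₙ) ∘ Pₙ⁻¹ ⇒ R̃(μ)`. -/
theorem stmt2 (d : ℕ) (hd : 1 ≤ d)
    (μn : ℕ → Measure (Fin d → ℕ)) (hμn : ∀ n, IsProbabilityMeasure (μn n))
    (μ : Measure (Fin d → ℝ)) (hμ : IsProbabilityMeasure μ)
    (hμsupp : μ {u | ∀ i, 0 ≤ u i} = 1)
    (hμconv : WeakConv
      (fun n => (μn n).map (fun v (i : Fin d) => (v i : ℝ) / Real.sqrt n)) μ)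
    (Rn : ℕ → (Fin d → ℕ) → Measure (Fin d → ℕ))
    (hRn : ∀ n v, IsProbabilityMeasure (Rn n v))
    (R : (Fin d → ℝ) → Measure (Fin d → ℝ))
    (hR : ∀ u, IsProbabilityMeasure (R u))
    (hRsupp : ∀ u : Fin d → ℝ, (∀ i, 0 ≤ u i) → R u {v | ∀ i, 0 ≤ v i} = 1)
    -- continuity of `R` for the topology of weak convergence:
    (hRcont : ∀ (useq : ℕ → (Fin d → ℝ)) (u : Fin d → ℝ),
      (∀ m i, 0 ≤ useq m i) → (∀ i, 0 ≤ u i) →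
      Tendsto useq atTop (nhds u) → WeakConv (fun m => R (useq m)) (R u))
    -- convergence of the kernels `Rₙ` to `R` along `Pₙ`-convergent sequences:
    (hRconv : ∀ (vseq : ℕ → (Fin d → ℕ)) (u : Fin d → ℝ), (∀ i, 0 ≤ u i) →
      Tendsto (fun n => fun i : Fin d => (vseq n i : ℝ) / Real.sqrt n) atTop (nhds u) →
      WeakConv
        (fun n => (Rn n (vseq n)).map (fun v (i : Fin d) => (v i : ℝ) / Real.sqrt n))
        (R u)) :
    WeakConv
      (fun n => ((μn n).bind (Rn n)).map (fun v (i : Fin d) => (v i : ℝ) / Real.sqrt n))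
      (μ.bind R) := by
  classical
  let P : ℕ → (Fin d → ℕ) → (Fin d → ℝ) := fun n v i => (v i : ℝ) / Real.sqrt n
  have hPm : ∀ n, Measurable (P n) := fun n => measurable_of_countable _
  have hP0 : ∀ n v i, 0 ≤ P n v i := fun n v i => by positivity
  let clip : (Fin d → ℝ) → (Fin d → ℝ) := fun u i => max (u i) 0
  have hclip : Continuous clip := by fun_prop
  have hclip0 : ∀ u i, 0 ≤ clip u i := fun u i => le_max_right _ _
  have hclipid : ∀ u : Fin d → ℝ, (∀ i, 0 ≤ u i) → clip u = u := fun u hu =>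
    funext fun i => max_eq_left (hu i)
  let R' : (Fin d → ℝ) → Measure (Fin d → ℝ) := fun u => R (clip u)
  have hR' : ∀ u, IsProbabilityMeasure (R' u) := fun u => hR _
  have hcont : ∀ φ : BoundedContinuousFunction (Fin d → ℝ) ℝ,
      Continuous fun u => ∫ x, φ x ∂(R' u) := by
    intro φ
    rw [continuous_iff_continuousAt]
    intro u
    refine tendsto_of_seq_tendsto fun x hx => ?_
    exact hRcont (fun m => clip (x m)) (clip u) (fun m => hclip0 _) (hclip0 _)
      ((hclip.tendsto u).comp hx) φ
  have hR'm : Measurable R' := aux_measurable R' hR' hcont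
  have hae : R =ᵐ[μ] R' := by
    have : ∀ᵐ u ∂μ, u ∈ {u : Fin d → ℝ | ∀ i, 0 ≤ u i} := by
      refine (mem_ae_iff_prob_eq_one ?_).2 hμsupp
      · simp only [Set.ofPred_forall]
        exact MeasurableSet.iInter fun i => measurableSet_le measurable_const (measurable_pi_apply i)
    filter_upwards [this] with u hu
    simp only [R', hclipid u hu]
  intro φ
  have hφ : ∀ x, ‖φ x‖ ≤ ‖φ‖ := φ.norm_coe_le_norm
  let g : (Fin d → ℝ) → ℝ := fun u => ∫ x, φ x ∂(R' u)
  let gn : ℕ → (Fin d → ℕ) → ℝ := fun n v => ∫ w, φ (P n w) ∂(Rn n v)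
  have hgb : ∀ u, ‖g u‖ ≤ ‖φ‖ := fun u => by
    have := norm_integral_le_of_norm_le_const (μ := R' u) (Eventually.of_forall hφ)
    simpa using this
  have hgnb : ∀ n v, ‖gn n v‖ ≤ ‖φ‖ := fun n v => by
    have := norm_integral_le_of_norm_le_const (μ := Rn n v)
      (Eventually.of_forall fun w => hφ (P n w))
    simpa using this
  have e1 : ∫ x, φ x ∂(μ.bind R) = ∫ u, g u ∂μ := by
    rw [Measure.bind_congr_right hae]
    exact aux_integral_bind μ R' hR'm hR' φ φ.continuous.measurable ‖φ‖ hφ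
  have e2 : ∀ n, ∫ x, φ x ∂(((μn n).bind (Rn n)).map (P n)) = ∫ v, gn n v ∂(μn n) := by
    intro n
    have := hμn n
    rw [integral_map (hPm n).aemeasurable φ.continuous.aestronglyMeasurable]
    exact aux_integral_bind (μn n) (Rn n) (measurable_of_countable _) (hRn n)
      (fun w => φ (P n w)) (φ.continuous.measurable.comp (hPm n)) ‖φ‖ (fun w => hφ _)
  show Tendsto (fun n => ∫ x, φ x ∂(((μn n).bind (Rn n)).map (P n))) atTop
    (nhds (∫ x, φ x ∂(μ.bind R)))
  simp_rw [e1, e2]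
  have conv : ∀ (ψ : (Fin d → ℝ) → ℝ) (C : ℝ), Continuous ψ → (∀ x, ‖ψ x‖ ≤ C) →
      Tendsto (fun n => ∫ v, ψ (P n v) ∂(μn n)) atTop (nhds (∫ u, ψ u ∂μ)) := by
    intro ψ C hψ hC
    have := hμconv (BoundedContinuousFunction.ofNormedAddCommGroup ψ hψ C hC)
    refine this.congr fun n => ?_
    exact integral_map (hPm n).aemeasurable hψ.aestronglyMeasurable
  -- local convergence
  have hloc : ∀ u : Fin d → ℝ, (∀ i, 0 ≤ u i) →
      Tendsto (fun p : ℕ × (Fin d → ℕ) => gn p.1 p.2 - g (P p.1 p.2))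
      (comap (fun p : ℕ × (Fin d → ℕ) => p.1) atTop ⊓
        comap (fun p : ℕ × (Fin d → ℕ) => P p.1 p.2) (nhds u)) (nhds 0) := by
    intro u hu
    have h1 := aux_local P u (fun n i => ⌊u i * Real.sqrt n⌋₊) (by
      rw [tendsto_pi_nhds]
      intro i
      exact (tendsto_nat_floor_mul_div_atTop (hu i)).comp
        (Real.tendsto_sqrt_atTop.comp tendsto_natCast_atTop_atTop)) gn (g u) (by
      intro vs hvs
      have := hRconv vs u hu hvs φ
      have h3 : R' u = R u := by simp only [R', hclipid u hu]
      simp only [g, h3]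
      refine this.congr fun n => ?_
      exact integral_map (hPm n).aemeasurable φ.continuous.aestronglyMeasurable)
    have h2 : Tendsto (fun p : ℕ × (Fin d → ℕ) => g (P p.1 p.2))
      (comap (fun p : ℕ × (Fin d → ℕ) => p.1) atTop ⊓
        comap (fun p : ℕ × (Fin d → ℕ) => P p.1 p.2) (nhds u)) (nhds (g u)) :=
      ((hcont φ).tendsto u).comp (tendsto_comap.mono_left inf_le_right)
    simpa using h1.sub h2
  have hunif : ∀ M : ℝ, ∀ ε > 0, ∀ᶠ n in atTop, ∀ v, ‖P n v‖ ≤ M →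
      |gn n v - g (P n v)| < ε := by
    intro M ε hε
    have hcl : IsClosed {u : Fin d → ℝ | ∀ i, 0 ≤ u i} := by
      simp only [Set.ofPred_forall]
      exact isClosed_iInter fun i => isClosed_le continuous_const (continuous_apply i)
    have := aux_compact P (Metric.closedBall 0 M ∩ {u : Fin d → ℝ | ∀ i, 0 ≤ u i})
      ((isCompact_closedBall _ _).inter_right hcl) (fun n v => gn n v - g (P n v))
      (fun u hu => hloc u hu.2) ε hε
    filter_upwards [this] with n hn v hv
    exact hn v ⟨by simpa using hv, hP0 n v⟩
  have hgn_int : ∀ n, Integrable (gn n) (μn n) := fun n => by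
    have := hμn n
    exact Integrable.of_bound (measurable_of_countable _).aestronglyMeasurable ‖φ‖
      (Eventually.of_forall (hgnb n))
  have hg_int : ∀ n, Integrable (fun v => g (P n v)) (μn n) := fun n => by
    have := hμn n
    exact Integrable.of_bound (measurable_of_countable _).aestronglyMeasurable ‖φ‖
      (Eventually.of_forall fun v => hgb _)
  have hdiff : Tendsto (fun n => ∫ v, gn n v ∂(μn n) - ∫ v, g (P n v) ∂(μn n)) atTop (nhds 0) := by
    rw [Metric.tendsto_atTop']
    intro ε hε
    have hC : 0 < 2 * ‖φ‖ + 1 := by positivity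
    obtain ⟨M, hM⟩ := ((aux_tight μ).eventually
      (gt_mem_nhds (show 0 < ε / 2 / (2 * ‖φ‖ + 1) by positivity))).exists
    have hb : ∀ u : Fin d → ℝ, ‖min 1 (max 0 (‖u‖ - M))‖ ≤ 1 := fun u => by
      rw [Real.norm_eq_abs, abs_of_nonneg (by positivity)]
      exact min_le_left _ _
    have hc := conv (fun u => min 1 (max 0 (‖u‖ - M))) 1 (by fun_prop) hb
    have hev := (hc.eventually (gt_mem_nhds hM)).and (hunif (M + 1) (ε / 2) (by positivity))
    obtain ⟨N, hN⟩ := eventually_atTop.1 hev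
    refine ⟨N, fun n hn => ?_⟩
    obtain ⟨h1, h2⟩ := hN n hn.le
    have := hμn n
    have hint : Integrable (fun v => min 1 (max 0 (‖P n v‖ - M))) (μn n) :=
      Integrable.of_bound (measurable_of_countable _).aestronglyMeasurable 1
        (Eventually.of_forall fun v => hb _)
    rw [dist_zero_right, ← integral_sub (hgn_int n) (hg_int n)]
    calc ‖∫ v, (gn n v - g (P n v)) ∂(μn n)‖
        ≤ ∫ v, (ε / 2 + (2 * ‖φ‖ + 1) * min 1 (max 0 (‖P n v‖ - M))) ∂(μn n) := by
          refine norm_integral_le_of_norm_le ((integrable_const _).add (hint.const_mul _))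
            (Eventually.of_forall fun v => ?_)
          by_cases hv : ‖P n v‖ ≤ M + 1
          · have h3 := h2 v hv
            have : 0 ≤ (2 * ‖φ‖ + 1) * min 1 (max 0 (‖P n v‖ - M)) := by positivity
            rw [Real.norm_eq_abs]
            linarith
          · have h3 : min 1 (max 0 (‖P n v‖ - M)) = 1 :=
              min_eq_left (le_max_of_le_right (by linarith))
            rw [h3]
            have := norm_sub_le (gn n v) (g (P n v))
            have := hgnb n v
            have := hgb (P n v)
            linarith
      _ = ε / 2 + (2 * ‖φ‖ + 1) * ∫ v, min 1 (max 0 (‖P n v‖ - M)) ∂(μn n) := by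
          rw [integral_add (integrable_const _) (hint.const_mul _), integral_const_mul]
          simp
      _ < ε := by
          have := (lt_div_iff₀' hC).1 h1
          linarith
  have := hdiff.add (conv g ‖φ‖ (hcont φ) hgb)
  simpa using this
end

section
/- Let d ≥ 1. For each i ≥ 1 let u_i : [0,∞) → ℝ^d be continuous and let t_i > 0 satisfy Σ_{i≥1} t_i = ∞. Define the concatenation g : [0,∞) → ℝ^d by g(t) := u_j(t − S_{j−1}) for S_{j−1} ≤ t < S_j. For each n let u_i^n : [0,∞) → ℝ^d and t_i^n ≥ 0 be such that, for every i, u_i^n → u_i uniformly on compact subsets of [0,∞) and t_i^n → t_i; let S_j^n and the concatenation g_n be defined analogously from (u_i^n), (t_i^n). Then for every T > 0 with T ≠ S_j for all j ≥ 1, for all sufficiently large n there exist continuous strictly increasing bijections λ_n : [0,T] → [0,T] such that sup_{t∈[0,T]} |λ_n(t) − t| → 0 and sup_{t∈[0,T]} ‖g_n(λ_n(t)) − g(t)‖ → 0 as n → ∞. -/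
open Filter

/-- Partial sums `S_j = t_0 + ⋯ + t_{j-1}` of a sequence of reals. -/
def pSum (t : ℕ → ℝ) (j : ℕ) : ℝ := ∑ i ∈ Finset.range j, t i

/-- The concatenation `g((u_i), (t_i))(s) = Σ_j u_j(s − S_j)·1{S_j ≤ s < S_{j+1}}`
of the paths `u_j` along the durations `t_j`. -/
noncomputable def concat {E : Type*} [AddCommMonoid E] [TopologicalSpace E]
    (u : ℕ → ℝ → E) (t : ℕ → ℝ) (s : ℝ) : E :=
  ∑' j : ℕ, if pSum t j ≤ s ∧ s < pSum t (j + 1) then u j (s - pSum t j) else 0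

theorem pSum_mono_aux (t : ℕ → ℝ) (ht : ∀ i, 0 ≤ t i) : Monotone (pSum t) := by
  apply monotone_nat_of_le_succ
  intro n
  simp only [pSum, Finset.sum_range_succ]
  linarith [ht n]

theorem concat_eq_aux {d : ℕ} (u : ℕ → ℝ → (Fin d → ℝ)) (t : ℕ → ℝ) (ht : ∀ i, 0 ≤ t i)
    (s : ℝ) (j : ℕ) (h1 : pSum t j ≤ s) (h2 : s < pSum t (j + 1)) :
    concat u t s = u j (s - pSum t j) := by
  unfold concat
  rw [tsum_eq_single j]
  · rw [if_pos ⟨h1, h2⟩]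
  · intro k hk
    rw [if_neg]
    rintro ⟨h3, h4⟩
    have hm := pSum_mono_aux t ht
    rcases lt_or_gt_of_ne hk with h | h
    · have := hm (show k + 1 ≤ j from h)
      linarith
    · have := hm (show j + 1 ≤ k from h)
      linarith

/-- hat function of half-width `δ` -/
noncomputable def hatF (δ x : ℝ) : ℝ := max 0 (1 - |x| / δ)

theorem hatF_zero (δ : ℝ) : hatF δ 0 = 1 := by simp [hatF]

theorem hatF_far (δ x : ℝ) (hδ : 0 < δ) (h : δ ≤ |x|) : hatF δ x = 0 := by
  unfold hatF
  apply max_eq_left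
  have : 1 ≤ |x| / δ := by rwa [le_div_iff₀ hδ, one_mul]
  linarith

theorem hatF_abs (δ x : ℝ) (hδ : 0 < δ) : |hatF δ x| ≤ 1 := by
  unfold hatF
  have : 0 ≤ |x| / δ := by positivity
  rw [abs_of_nonneg (le_max_left _ _)]
  exact max_le (by norm_num) (by linarith)

theorem hatF_lip (δ x y : ℝ) (hδ : 0 < δ) : |hatF δ x - hatF δ y| ≤ |x - y| / δ := by
  unfold hatF
  have h := abs_max_sub_max_le_abs (1 - |x| / δ) (1 - |y| / δ) 0
  rw [max_comm 0, max_comm 0]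
  refine h.trans ?_
  have e : (1 - |x| / δ) - (1 - |y| / δ) = (|y| - |x|) / δ := by ring
  rw [e, abs_div, abs_of_pos hδ]
  have := abs_abs_sub_abs_le y x
  rw [abs_sub_comm x y]
  gcongr

theorem hatF_cont (δ : ℝ) : Continuous (hatF δ) := by
  unfold hatF
  fun_prop

/-- the time change -/
noncomputable def lamF (δ : ℝ) (m : ℕ) (p q : ℕ → ℝ) (s : ℝ) : ℝ :=
  s + ∑ j ∈ Finset.range (m + 1), (q j - p j) * hatF δ (s - p j)

/-- the total error -/
noncomputable def errF (m : ℕ) (p q : ℕ → ℝ) : ℝ :=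
  ∑ j ∈ Finset.range (m + 1), |q j - p j|

theorem lamF_close (δ : ℝ) (hδ : 0 < δ) (m : ℕ) (p q : ℕ → ℝ) (s : ℝ) :
    |lamF δ m p q s - s| ≤ errF m p q := by
  unfold lamF errF
  rw [add_sub_cancel_left]
  refine (Finset.abs_sum_le_sum_abs _ _).trans (Finset.sum_le_sum fun j _ => ?_)
  rw [abs_mul]
  exact mul_le_of_le_one_right (abs_nonneg _) (hatF_abs _ _ hδ)

theorem lamF_cont (δ : ℝ) (m : ℕ) (p q : ℕ → ℝ) : Continuous (lamF δ m p q) := by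
  unfold lamF
  have := hatF_cont δ
  fun_prop

theorem lamF_strictMono (δ : ℝ) (hδ : 0 < δ) (m : ℕ) (p q : ℕ → ℝ) (h : errF m p q < δ) :
    StrictMono (lamF δ m p q) := by
  intro x y hxy
  have key : |∑ j ∈ Finset.range (m + 1), (q j - p j) * (hatF δ (x - p j) - hatF δ (y - p j))|
      ≤ errF m p q * ((y - x) / δ) := by
    unfold errF
    rw [Finset.sum_mul]
    refine (Finset.abs_sum_le_sum_abs _ _).trans (Finset.sum_le_sum fun j _ => ?_)
    rw [abs_mul]
    have := hatF_lip δ (x - p j) (y - p j) hδ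
    rw [sub_sub_sub_cancel_right, abs_sub_comm x y, abs_of_pos (sub_pos.2 hxy)] at this
    gcongr
  have h2 : errF m p q * ((y - x) / δ) < y - x := by
    have : 0 < y - x := sub_pos.2 hxy
    calc errF m p q * ((y - x) / δ) < δ * ((y - x) / δ) := by gcongr
      _ = y - x := by field_simp
  have h3 := (abs_lt.1 (key.trans_lt h2)).2
  simp only [mul_sub, Finset.sum_sub_distrib] at h3
  unfold lamF
  linarith

theorem lamF_far (δ : ℝ) (hδ : 0 < δ) (m : ℕ) (p q : ℕ → ℝ) (s : ℝ)
    (h : ∀ j ≤ m, δ ≤ |s - p j|) : lamF δ m p q s = s := by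
  unfold lamF
  rw [Finset.sum_eq_zero, add_zero]
  intro j hj
  rw [hatF_far δ _ hδ (h j (by simpa [Nat.lt_succ_iff] using hj)), mul_zero]

theorem lamF_node (δ : ℝ) (hδ : 0 < δ) (m : ℕ) (p q : ℕ → ℝ) (k : ℕ) (hk : k ≤ m)
    (h : ∀ j ≤ m, j ≠ k → δ ≤ |p k - p j|) : lamF δ m p q (p k) = q k := by
  unfold lamF
  rw [Finset.sum_eq_single k]
  · rw [sub_self, hatF_zero]; ring
  · intro j hj hjk
    rw [hatF_far δ _ hδ (h j (by simpa [Nat.lt_succ_iff] using hj) hjk), mul_zero]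
  · intro hn
    exact absurd (Finset.mem_range.2 (Nat.lt_succ_of_le hk)) hn

theorem stmt3 (d : ℕ) (hd : 1 ≤ d)
    (u : ℕ → ℝ → (Fin d → ℝ)) (hu : ∀ i, Continuous (u i))
    (t : ℕ → ℝ) (ht : ∀ i, 0 < t i)
    (htsum : Tendsto (fun j => pSum t j) atTop atTop)
    (un : ℕ → ℕ → ℝ → (Fin d → ℝ)) (tn : ℕ → ℕ → ℝ)
    (htn_nonneg : ∀ n i, 0 ≤ tn n i)
    (hun : ∀ (i : ℕ) (T : ℝ), 0 < T →
      TendstoUniformlyOn (fun n s => un n i s) (u i) atTop (Set.Icc 0 T))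
    (htn : ∀ i, Tendsto (fun n => tn n i) atTop (nhds (t i))) :
    ∀ T : ℝ, 0 < T → (∀ j : ℕ, 1 ≤ j → pSum t j ≠ T) →
      ∃ lam : ℕ → ℝ → ℝ,
        (∀ᶠ n in atTop,
          ContinuousOn (lam n) (Set.Icc 0 T) ∧
          StrictMonoOn (lam n) (Set.Icc 0 T) ∧
          Set.BijOn (lam n) (Set.Icc 0 T) (Set.Icc 0 T)) ∧
        TendstoUniformlyOn (fun n s => lam n s) (fun s => s) atTop (Set.Icc 0 T) ∧
        TendstoUniformlyOn (fun n s => concat (un n) (tn n) (lam n s))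
          (fun s => concat u t s) atTop (Set.Icc 0 T) := by
  intro T hT hTne
  have ht0 : ∀ i, 0 ≤ t i := fun i => (ht i).le
  have hmono := pSum_mono_aux t ht0
  have hsucc : ∀ (t : ℕ → ℝ) j, pSum t (j + 1) = pSum t j + t j := by
    intro t j
    simp [pSum, Finset.sum_range_succ]
  have hz : ∀ t : ℕ → ℝ, pSum t 0 = 0 := by intro t; simp [pSum]
  have hfind : ∀ s : ℝ, 0 ≤ s → ∃ j, pSum t j ≤ s ∧ s < pSum t (j + 1) := by
    intro s hs
    have hex : ∃ k, s < pSum t k := (htsum.eventually_gt_atTop s).exists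
    classical
    have h1 := Nat.find_spec hex
    have h0 : Nat.find hex ≠ 0 := by
      intro h
      rw [h, hz] at h1
      linarith
    obtain ⟨j, hj⟩ := Nat.exists_eq_succ_of_ne_zero h0
    refine ⟨j, not_lt.1 (Nat.find_min hex (by omega)), ?_⟩
    rw [hj] at h1
    exact h1
  obtain ⟨m, hm1', hm2⟩ := hfind T hT.le
  have hm1 : pSum t m < T := by
    rcases Nat.eq_zero_or_pos m with h | h
    · rw [h, hz]; exact hT
    · exact lt_of_le_of_ne hm1' (hTne m h)
  obtain ⟨δ, hδ, hδt, hδT⟩ : ∃ δ : ℝ, 0 < δ ∧ (∀ i ≤ m, δ ≤ t i) ∧ δ ≤ T - pSum t m := by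
    have hne : (Finset.range (m + 1)).Nonempty := ⟨0, by simp⟩
    obtain ⟨i, _, hi⟩ := Finset.exists_min_image (Finset.range (m + 1)) t hne
    refine ⟨min (t i) (T - pSum t m), lt_min (ht i) (by linarith), ?_, min_le_right _ _⟩
    intro k hk
    exact (min_le_left _ _).trans (hi k (Finset.mem_range.2 (by omega)))
  have hgap : ∀ j k, j < k → k ≤ m → δ ≤ pSum t k - pSum t j := by
    intro j k hjk hk
    have h1 := hmono (show j + 1 ≤ k from hjk)
    rw [hsucc] at h1
    linarith [hδt j (by omega)]
  have hS : ∀ j, Tendsto (fun n => pSum (tn n) j) atTop (nhds (pSum t j)) := by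
    intro j
    unfold pSum
    exact tendsto_finsetSum _ fun i _ => htn i
  have herr : Tendsto (fun n => errF m (pSum t) (pSum (tn n))) atTop (nhds 0) := by
    unfold errF
    have : Tendsto (fun n => ∑ j ∈ Finset.range (m + 1), |pSum (tn n) j - pSum t j|) atTop
        (nhds (∑ j ∈ Finset.range (m + 1), |pSum t j - pSum t j|)) :=
      tendsto_finsetSum _ fun j _ => ((hS j).sub_const _).abs
    simpa using this
  have hlamT : ∀ n, lamF δ m (pSum t) (pSum (tn n)) T = T := by
    intro n
    apply lamF_far δ hδ
    intro j hj
    have := hmono hj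
    exact le_trans (by linarith) (le_abs_self _)
  have hlamN : ∀ n k, k ≤ m → lamF δ m (pSum t) (pSum (tn n)) (pSum t k) = pSum (tn n) k := by
    intro n k hk
    apply lamF_node δ hδ _ _ _ _ hk
    intro j hj hjk
    rcases lt_or_gt_of_ne hjk with h | h
    · exact (hgap j k h hk).trans (le_abs_self _)
    · rw [abs_sub_comm]
      exact (hgap k j h hj).trans (le_abs_self _)
  have hlam0 : ∀ n, lamF δ m (pSum t) (pSum (tn n)) 0 = 0 := by
    intro n
    have := hlamN n 0 (Nat.zero_le _)
    rwa [hz, hz] at this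
  have hevmono : ∀ᶠ n in atTop, StrictMono (lamF δ m (pSum t) (pSum (tn n))) := by
    filter_upwards [herr.eventually_lt_const hδ] with n hn
    exact lamF_strictMono δ hδ _ _ _ hn
  refine ⟨fun n => lamF δ m (pSum t) (pSum (tn n)), ?_, ?_, ?_⟩
  · filter_upwards [hevmono] with n hn
    have hc := (lamF_cont δ m (pSum t) (pSum (tn n))).continuousOn (s := Set.Icc 0 T)
    refine ⟨hc, hn.strictMonoOn _, ?_, hn.injective.injOn, ?_⟩
    · intro s hs
      have h1 := hn.monotone hs.1
      have h2 := hn.monotone hs.2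
      rw [hlam0] at h1
      rw [hlamT] at h2
      exact ⟨h1, h2⟩
    · have := intermediate_value_Icc hT.le hc
      rwa [hlam0, hlamT] at this
  · rw [Metric.tendstoUniformlyOn_iff]
    intro ε hε
    filter_upwards [herr.eventually_lt_const hε] with n hn s _
    rw [dist_comm, Real.dist_eq]
    exact (lamF_close δ hδ _ _ _ s).trans_lt hn
  · rw [Metric.tendstoUniformlyOn_iff]
    intro ε hε
    have huc : ∀ j, ∃ η > 0, ∀ x ∈ Set.Icc 0 T, ∀ y ∈ Set.Icc 0 T, dist x y < η →
        dist (u j x) (u j y) < ε / 2 := fun j =>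
      Metric.uniformContinuousOn_iff.1
        (isCompact_Icc.uniformContinuousOn_of_continuous (hu j).continuousOn) (ε / 2) (half_pos hε)
    have hev : ∀ j ∈ Finset.range (m + 1), ∀ᶠ n in atTop, ∀ x ∈ Set.Icc 0 T, ∀ y ∈ Set.Icc 0 T,
        dist x y ≤ 2 * errF m (pSum t) (pSum (tn n)) → dist (u j x) (un n j y) < ε := by
      intro j _
      obtain ⟨η, hη, hη2⟩ := huc j
      have h1 := Metric.tendstoUniformlyOn_iff.1 (hun j T hT) (ε / 2) (half_pos hε)
      filter_upwards [h1, herr.eventually_lt_const (half_pos hη)] with n hn1 hn2 x hx y hy hxy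
      have a := hn1 y hy
      have b := hη2 x hx y hy (by linarith)
      linarith [dist_triangle (u j x) (u j y) (un n j y)]
    rw [← Filter.eventually_all_finset] at hev
    filter_upwards [hev, hevmono, (hS (m + 1)).eventually_const_lt hm2] with n hn hmon hTn s hs
    obtain ⟨j, hj1, hj2⟩ := hfind s hs.1
    have hjm : j ≤ m := by
      by_contra hlt
      have := hmono (show m + 1 ≤ j by omega)
      linarith [hs.2]
    have hl1 : pSum (tn n) j ≤ lamF δ m (pSum t) (pSum (tn n)) s := by
      rw [← hlamN n j hjm]
      exact hmon.monotone hj1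
    have hlT : lamF δ m (pSum t) (pSum (tn n)) s ≤ T := by
      have := hmon.monotone hs.2
      rwa [hlamT] at this
    have hl2 : lamF δ m (pSum t) (pSum (tn n)) s < pSum (tn n) (j + 1) := by
      rcases hjm.lt_or_eq with h | h
      · rw [← hlamN n (j + 1) h]
        exact hmon hj2
      · rw [h]
        exact hlT.trans_lt hTn
    have hp : 0 ≤ pSum t j := by
      have := hmono (Nat.zero_le j)
      rwa [hz] at this
    have hq : 0 ≤ pSum (tn n) j := by
      have := pSum_mono_aux _ (htn_nonneg n) (Nat.zero_le j)
      rwa [hz] at this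
    rw [concat_eq_aux u t ht0 s j hj1 hj2,
      concat_eq_aux (un n) (tn n) (htn_nonneg n) _ j hl1 hl2]
    have hjr : j ∈ Finset.range (m + 1) := Finset.mem_range.2 (by omega)
    refine hn j hjr _ ⟨by linarith, by linarith [hs.2]⟩ _ ⟨by linarith, by linarith⟩ ?_
    have e1 := lamF_close δ hδ m (pSum t) (pSum (tn n)) s
    have e2 : |pSum (tn n) j - pSum t j| ≤ errF m (pSum t) (pSum (tn n)) :=
      Finset.single_le_sum (f := fun j => |pSum (tn n) j - pSum t j|)
        (fun _ _ => abs_nonneg _) hjr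
    rw [Real.dist_eq, abs_le]
    rw [abs_le] at e1 e2
    constructor <;> linarith [e1.1, e1.2, e2.1, e2.2]
end

section
/- For each N ≥ 2 let ν_N be a Borel probability measure on ℝ^{N−1} such that the pushforwards ν_N ∘ Q_N^{-1} converge weakly to a Borel probability measure ν on C_0((0,1)). Let R^N : ℝ^{N−1} → 𝒫(ℝ^{N−1}) be Borel measurable maps and let R : C_0((0,1)) → 𝒫(C_0((0,1))) be continuous when 𝒫 carries the topology of weak convergence, such that: whenever X_N ∈ ℝ^{N−1} satisfy ‖Q_N(X_N) − u‖_∞ → 0 for some u ∈ C_0((0,1)), the measures R^N(X_N) ∘ Q_N^{-1} converge weakly to R(u). Define the mixtures R̃^N(ν_N)(A) := ∫ R^N(X)(A) ν_N(dX) and R̃(ν)(B) := ∫ R(u)(B) ν(du). Then R̃^N(ν_N) ∘ Q_N^{-1} converges weakly to R̃(ν) in 𝒫(C_0((0,1))). -/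
open Filter MeasureTheory

noncomputable instance : MeasurableSpace C(Set.Icc (0:ℝ) 1, ℝ) := borel _
instance : BorelSpace C(Set.Icc (0:ℝ) 1, ℝ) := ⟨rfl⟩

/-- The raw piecewise-linear interpolation: `QNfun N X (i/N) = Xᵢ/√N` for
`i = 1, …, N−1`, `QNfun N X 0 = QNfun N X 1 = 0`, affine on each
`[i/N, (i+1)/N]` (written as a sum of hat functions). -/
noncomputable def QNfun (N : ℕ) (X : Fin (N - 1) → ℝ) : ℝ → ℝ :=
  fun p => ∑ i : Fin (N - 1), (X i / Real.sqrt N) * max 0 (1 - |(N : ℝ) * p - ((i : ℕ) + 1)|)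

/-- The interpolation operator `Q_N : ℝ^{N−1} → C_0((0,1))`, viewed as a map
into `C([0,1], ℝ)` (its image consists of functions vanishing at `0` and `1`). -/
noncomputable def QNc (N : ℕ) (X : Fin (N - 1) → ℝ) : C(Set.Icc (0:ℝ) 1, ℝ) :=
  ⟨fun p => QNfun N X p, by
    apply Continuous.comp (g := QNfun N X) ?_ continuous_subtype_val
    unfold QNfun
    apply continuous_finset_sum
    intro i _
    fun_prop⟩


open scoped Topology

abbrev CI6 := C(Set.Icc (0:ℝ) 1, ℝ)

lemma QNc_apply6 (N : ℕ) (X : Fin (N - 1) → ℝ) (p : Set.Icc (0:ℝ) 1) :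
    QNc N X p = ∑ i : Fin (N - 1),
      (X i / Real.sqrt N) * max 0 (1 - |(N : ℝ) * p - ((i : ℕ) + 1)|) := rfl

lemma continuous_QNc6 (N : ℕ) : Continuous (QNc N) := by
  apply ContinuousMap.continuous_of_continuous_uncurry
  have : Function.uncurry (fun (X : Fin (N - 1) → ℝ) (p : Set.Icc (0:ℝ) 1) => QNc N X p) =
      fun q => ∑ i : Fin (N - 1),
      (q.1 i / Real.sqrt N) * max 0 (1 - |(N : ℝ) * q.2 - ((i : ℕ) + 1)|) := by
    ext q; rfl
  change Continuous (Function.uncurry (fun (X : Fin (N - 1) → ℝ) (p : Set.Icc (0:ℝ) 1) => QNc N X p))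
  rw [this]
  apply continuous_finset_sum
  intro i _
  fun_prop

lemma QNc_zero6 (N : ℕ) (X : Fin (N - 1) → ℝ) (h : (0:ℝ) ∈ Set.Icc (0:ℝ) 1) :
    QNc N X ⟨0, h⟩ = 0 := by
  rw [QNc_apply6]
  apply Finset.sum_eq_zero
  intro i _
  have h0 : (0:ℝ) ≤ ((i : ℕ) : ℝ) := Nat.cast_nonneg _
  have : max 0 (1 - |(N : ℝ) * (0:ℝ) - (((i : ℕ) : ℝ) + 1)|) = 0 := by
    apply max_eq_left
    rw [mul_zero, zero_sub, abs_neg, abs_of_nonneg (by linarith)]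
    linarith
  exact (congrArg _ this).trans (mul_zero _)

lemma QNc_one6 (N : ℕ) (X : Fin (N - 1) → ℝ) (h : (1:ℝ) ∈ Set.Icc (0:ℝ) 1) :
    QNc N X ⟨1, h⟩ = 0 := by
  rw [QNc_apply6]
  apply Finset.sum_eq_zero
  intro i _
  have h1 : (i : ℕ) + 2 ≤ N := by have := i.2; omega
  have h0 : ((i : ℕ) : ℝ) + 2 ≤ N := by exact_mod_cast h1
  have : max 0 (1 - |(N : ℝ) * (1:ℝ) - (((i : ℕ) : ℝ) + 1)|) = 0 := by
    apply max_eq_left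
    rw [mul_one, abs_of_nonneg (by linarith)]
    linarith
  exact (congrArg _ this).trans (mul_zero _)

lemma hat_sum6 (x : ℝ) (hx : 0 ≤ x) (n : ℕ) :
    ∑ i ∈ Finset.range (n + 1), max 0 (1 - |x - (i : ℝ)|) = min 1 (max 0 (n + 1 - x)) := by
  induction n with
  | zero =>
    simp [abs_of_nonneg hx, hx]
  | succ n ih =>
    rw [Finset.sum_range_succ, ih]
    push_cast
    rcases abs_cases (x - ((n:ℝ) + 1)) with h | h <;>
    rcases max_cases 0 (1 - |x - ((n:ℝ) + 1)|) with h1 | h1 <;>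
    rcases max_cases 0 ((n:ℝ) + 1 - x) with h2 | h2 <;>
    rcases max_cases 0 ((n:ℝ) + 1 + 1 - x) with h3 | h3 <;>
    rcases min_cases 1 (max 0 ((n:ℝ) + 1 - x)) with h4 | h4 <;>
    rcases min_cases 1 (max 0 ((n:ℝ) + 1 + 1 - x)) with h5 | h5 <;>
    linarith

/-- sampling of `u` -/
noncomputable def samp6 (u : CI6) (N : ℕ) : Fin (N - 1) → ℝ :=
  fun i => Real.sqrt N * Set.IccExtend (zero_le_one' ℝ) u ((((i : ℕ) : ℝ) + 1) / N)

lemma QNc_samp6 (u : CI6) (h0 : ∀ h, u ⟨0, h⟩ = 0) (h1 : ∀ h, u ⟨1, h⟩ = 0)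
    (n : ℕ) (p : Set.Icc (0:ℝ) 1) :
    QNc (n + 1) (samp6 u (n + 1)) p = ∑ i ∈ Finset.range (n + 2),
      Set.IccExtend (zero_le_one' ℝ) u ((i : ℝ) / ((n + 1 : ℕ) : ℝ))
        * max 0 (1 - |((n + 1 : ℕ) : ℝ) * p - (i : ℝ)|) := by
  have e0 : Set.IccExtend (zero_le_one' ℝ) u 0 = 0 := by
    rw [Set.IccExtend_of_mem _ _ (by norm_num : (0:ℝ) ∈ Set.Icc (0:ℝ) 1)]; exact h0 _
  have e1 : Set.IccExtend (zero_le_one' ℝ) u 1 = 0 := by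
    rw [Set.IccExtend_of_mem _ _ (by norm_num : (1:ℝ) ∈ Set.Icc (0:ℝ) 1)]; exact h1 _
  have hn : (((n + 1 : ℕ)) : ℝ) ≠ 0 := by positivity
  rw [Finset.sum_range_succ, Finset.sum_range_succ', div_self hn, e1]
  simp only [Nat.cast_zero, zero_div, e0, zero_mul, add_zero]
  rw [QNc_apply6, Finset.sum_range]
  apply Finset.sum_congr rfl
  intro i _
  have hs : Real.sqrt ((n + 1 : ℕ) : ℝ) ≠ 0 := by positivity
  unfold samp6
  rw [mul_div_cancel_left₀ _ hs]
  push_cast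
  rfl

lemma samp_tendsto6 (u : CI6) (h0 : ∀ h, u ⟨0, h⟩ = 0) (h1 : ∀ h, u ⟨1, h⟩ = 0) :
    Tendsto (fun N => dist (QNc N (samp6 u N)) u) atTop (𝓝 0) := by
  rw [Metric.tendsto_atTop]
  intro ε hε
  have hu : UniformContinuous u := CompactSpace.uniformContinuous_of_continuous u.continuous
  obtain ⟨δ, hδ, hd⟩ := Metric.uniformContinuous_iff.1 hu (ε / 2) (by positivity)
  obtain ⟨m, hm⟩ := exists_nat_gt (1 / δ)
  refine ⟨m + 1, fun N hN => ?_⟩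
  obtain ⟨n, rfl⟩ : ∃ n, N = n + 1 := ⟨N - 1, by omega⟩
  rw [dist_zero_right, Real.norm_eq_abs, abs_of_nonneg dist_nonneg]
  refine lt_of_le_of_lt ?_ (half_lt_self hε)
  rw [ContinuousMap.dist_le (by positivity)]
  intro p
  have hp := p.2
  have hN0 : (0:ℝ) < ((n + 1 : ℕ) : ℝ) := by positivity
  have hNd : 1 / δ < ((n + 1 : ℕ) : ℝ) :=
    hm.trans_le (by exact_mod_cast (by omega : m ≤ n + 1))
  have hsum : ∑ i ∈ Finset.range (n + 2), max 0 (1 - |((n + 1 : ℕ) : ℝ) * p - (i : ℝ)|) = 1 := by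
    rw [hat_sum6 _ (mul_nonneg hN0.le hp.1) (n + 1)]
    have : ((n + 1 : ℕ) : ℝ) * p ≤ ((n + 1 : ℕ) : ℝ) := mul_le_of_le_one_right hN0.le hp.2
    apply min_eq_left
    apply le_max_of_le_right
    linarith
  rw [QNc_samp6 u h0 h1, Real.dist_eq]
  have : u p = ∑ i ∈ Finset.range (n + 2),
      u p * max 0 (1 - |((n + 1 : ℕ) : ℝ) * p - (i : ℝ)|) := by
    rw [← Finset.mul_sum, hsum, mul_one]
  rw [this, ← Finset.sum_sub_distrib]
  refine (Finset.abs_sum_le_sum_abs _ _).trans ?_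
  calc _ ≤ ∑ i ∈ Finset.range (n + 2),
      ε / 2 * max 0 (1 - |((n + 1 : ℕ) : ℝ) * p - (i : ℝ)|) := by
        apply Finset.sum_le_sum
        intro i hi
        rw [← sub_mul, abs_mul, abs_of_nonneg (le_max_left 0 (1 - |((n + 1 : ℕ) : ℝ) * p - (i : ℝ)|))]
        by_cases hc : |((n + 1 : ℕ) : ℝ) * p - (i : ℝ)| < 1
        · apply mul_le_mul_of_nonneg_right _ (le_max_left _ _)
          have hi' : (i : ℝ) ≤ ((n + 1 : ℕ) : ℝ) := by
            have := Finset.mem_range.1 hi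
            exact_mod_cast (by omega : i ≤ n + 1)
          have hmem : (i : ℝ) / ((n + 1 : ℕ) : ℝ) ∈ Set.Icc (0:ℝ) 1 :=
            ⟨by positivity, (div_le_one hN0).2 hi'⟩
          rw [Set.IccExtend_of_mem _ _ hmem, ← Real.dist_eq]
          apply (hd _).le
          rw [Subtype.dist_eq, dist_comm, Real.dist_eq]
          have : (p : ℝ) - (i : ℝ) / ((n + 1 : ℕ) : ℝ) =
              (((n + 1 : ℕ) : ℝ) * p - (i : ℝ)) / ((n + 1 : ℕ) : ℝ) := by
            field_simp
          change |(p : ℝ) - (i : ℝ) / ((n + 1 : ℕ) : ℝ)| < δ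
          rw [this, abs_div, abs_of_pos hN0, div_lt_iff₀ hN0]
          rw [div_lt_iff₀ hδ] at hNd
          linarith
        · rw [max_eq_left (by linarith)]; simp
    _ = ε / 2 := by rw [← Finset.mul_sum, hsum, mul_one]

lemma integral_bind6 {α β : Type*} [MeasurableSpace α] [MeasurableSpace β]
    (m : Measure α) (κ : α → Measure β) (hκ : Measurable κ) (f : β → ℝ)
    (hf : Integrable f (m.bind κ)) :
    ∫ y, f y ∂(m.bind κ) = ∫ x, ∫ y, f y ∂(κ x) ∂m := by
  have := ProbabilityTheory.Kernel.integral_comp (η := (⟨κ, hκ⟩ : ProbabilityTheory.Kernel α β))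
    (κ := ProbabilityTheory.Kernel.const Unit m) (a := ()) (f := f)
    (by simpa [ProbabilityTheory.Kernel.comp_apply] using hf)
  simpa [ProbabilityTheory.Kernel.comp_apply] using this

lemma measurable_of_weak6 (R : CI6 → Measure CI6) (hRprob : ∀ u, IsProbabilityMeasure (R u))
    (hRcont : ∀ (useq : ℕ → CI6) (u : CI6),
      Tendsto useq atTop (nhds u) → WeakConv (fun m => R (useq m)) (R u)) :
    Measurable R := by
  let P : CI6 → ProbabilityMeasure CI6 := fun u => ⟨R u, hRprob u⟩
  have hP : Continuous P := by
    apply continuous_iff_seqContinuous.2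
    intro us u hu
    rw [ProbabilityMeasure.tendsto_iff_forall_integral_tendsto]
    exact hRcont us u hu
  refine Measurable.measure_of_isPiSystem_of_isProbabilityMeasure (S := {s | IsClosed s})
    ?_ isPiSystem_isClosed ?_
  · rw [← borel_eq_generateFrom_isClosed]; rfl
  · intro F hF
    have hF : IsClosed F := hF
    refine measurable_of_tendsto_metrizable (f := fun n u => ∫⁻ x, hF.apprSeq n x ∂(R u)) ?_ ?_
    · intro n
      apply Continuous.measurable
      rw [continuous_iff_continuousAt]
      intro u
      exact ProbabilityMeasure.tendsto_iff_forall_lintegral_tendsto.1 (hP.tendsto u) _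
    · rw [tendsto_pi_nhds]
      intro u
      exact HasOuterApproxClosed.tendsto_lintegral_apprSeq hF (R u)

lemma key6 (νN : (N : ℕ) → Measure (Fin (N - 1) → ℝ)) (hνN : ∀ N, IsProbabilityMeasure (νN N))
    (ν : Measure CI6) (hν : IsProbabilityMeasure ν)
    (hνconv : WeakConv (fun N => (νN N).map (QNc N)) ν)
    (G : (N : ℕ) → (Fin (N - 1) → ℝ) → ℝ) (C : ℝ) (hC : 0 ≤ C)
    (hG : ∀ N X, |G N X| ≤ C)
    (h : ∀ ε > 0, ∀ u : CI6, ∃ m : ℕ, ∃ δ > 0, ∀ N ≥ m, ∀ X, dist (QNc N X) u < δ → |G N X| ≤ ε) :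
    Tendsto (fun N => ∫ X, G N X ∂(νN N)) atTop (𝓝 0) := by
  rw [Metric.tendsto_atTop]
  intro ε hε
  let V : ℕ → Set CI6 := fun m =>
    {u | ∃ δ > 0, ∀ N ≥ m, ∀ X, dist (QNc N X) u < δ → |G N X| ≤ ε / 2}
  have hVo : ∀ m, IsOpen (V m) := by
    intro m
    rw [Metric.isOpen_iff]
    rintro u ⟨δ, hδ, hu⟩
    refine ⟨δ / 2, by positivity, fun v hv => ⟨δ / 2, by positivity, fun N hN X hX => hu N hN X ?_⟩⟩
    have := dist_triangle (QNc N X) v u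
    rw [Metric.mem_ball] at hv
    linarith
  have hVm : Antitone (fun m => (V m)ᶜ) := by
    intro a b hab
    apply Set.compl_subset_compl.2
    rintro u ⟨δ, hδ, hu⟩
    exact ⟨δ, hδ, fun N hN X hX => hu N (hab.trans hN) X hX⟩
  have hVi : ⋂ m, (V m)ᶜ = ∅ := by
    rw [Set.eq_empty_iff_forall_notMem]
    intro u hu
    obtain ⟨m, δ, hδ, hm⟩ := h (ε / 2) (by positivity) u
    exact Set.mem_iInter.1 hu m ⟨δ, hδ, hm⟩
  have ht := tendsto_measure_iInter_atTop (μ := ν)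
    (fun m => (hVo m).measurableSet.compl.nullMeasurableSet) hVm ⟨0, measure_ne_top _ _⟩
  rw [hVi, measure_empty] at ht
  set η : ℝ := ε / (4 * (C + 1)) with hη
  have hηp : 0 < η := by positivity
  obtain ⟨m, hm⟩ := (ht.eventually_lt_const (ENNReal.ofReal_pos.2 hηp)).exists
  have hpr : ∀ N, IsProbabilityMeasure ((νN N).map (QNc N)) := fun N =>
    Measure.isProbabilityMeasure_map (continuous_QNc6 N).measurable.aemeasurable
  have htend : Tendsto (β := ProbabilityMeasure CI6) (fun N => ⟨(νN N).map (QNc N), hpr N⟩) atTop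
      (𝓝 ⟨ν, hν⟩) := by
    exact ProbabilityMeasure.tendsto_iff_forall_integral_tendsto.2 hνconv
  have hls := ProbabilityMeasure.limsup_measure_closed_le_of_tendsto htend (hVo m).isClosed_compl
  have hev := eventually_lt_of_limsup_lt (hls.trans_lt hm)
  obtain ⟨M, hM⟩ := (hev.and (eventually_ge_atTop m)).exists_forall_of_atTop
  refine ⟨M, fun N hN => ?_⟩
  obtain ⟨h1, h2⟩ := hM N hN
  have hms : MeasurableSet (QNc N ⁻¹' (V m)ᶜ) :=
    (continuous_QNc6 N).measurable (hVo m).measurableSet.compl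
  change (νN N).map (QNc N) (V m)ᶜ < _ at h1
  rw [Measure.map_apply (continuous_QNc6 N).measurable (hVo m).measurableSet.compl] at h1
  have h3 : (νN N).real (QNc N ⁻¹' (V m)ᶜ) < η :=
    (ENNReal.lt_ofReal_iff_toReal_lt (measure_ne_top _ _)).1 h1
  rw [dist_zero_right]
  have hint : Integrable (fun X => ε / 2 + (QNc N ⁻¹' (V m)ᶜ).indicator (fun _ => C) X) (νN N) :=
    (integrable_const _).add ((integrable_const _).indicator hms)
  have hb := norm_integral_le_of_norm_le (f := G N) hint (Eventually.of_forall fun X => by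
    rw [Real.norm_eq_abs]
    by_cases hX : X ∈ QNc N ⁻¹' (V m)ᶜ
    · rw [Set.indicator_of_mem hX]
      linarith [hG N X]
    · rw [Set.indicator_of_notMem hX]
      have hX' : QNc N X ∈ V m := by
        by_contra hcon; exact hX hcon
      obtain ⟨δ, hδ, hu⟩ := hX'
      linarith [hu N h2 X (by simpa using hδ)])
  rw [integral_add (integrable_const _) ((integrable_const _).indicator hms),
    integral_indicator_const _ hms] at hb
  simp only [integral_const, probReal_univ, one_smul, smul_eq_mul] at hb
  refine hb.trans_lt ?_
  have h4 : (νN N).real (QNc N ⁻¹' (V m)ᶜ) * C ≤ η * C :=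
    mul_le_mul_of_nonneg_right h3.le hC
  have h5 : η * (C + 1) = ε / 4 := by rw [hη]; field_simp
  nlinarith

/-- From convergence along full sequences to a local uniform bound. -/
lemma local6 (G : (N : ℕ) → (Fin (N - 1) → ℝ) → ℝ)
    (hG : ∀ (XN : (N : ℕ) → Fin (N - 1) → ℝ) (u : CI6),
      Tendsto (fun N => dist (QNc N (XN N)) u) atTop (𝓝 0) →
      Tendsto (fun N => G N (XN N)) atTop (𝓝 0)) :
    ∀ ε > 0, ∀ u : CI6, ∃ m : ℕ, ∃ δ > 0, ∀ N ≥ m, ∀ X, dist (QNc N X) u < δ → |G N X| ≤ ε := by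
  intro ε hε u
  by_contra! hcon
  have hfr : ∀ k : ℕ, ∃ᶠ N in atTop, ∃ X, dist (QNc N X) u < 1 / ((k : ℝ) + 1) ∧ ε < |G N X| := by
    intro k
    rw [frequently_atTop]
    intro m
    obtain ⟨N, hN, X, hX⟩ := hcon m (1 / ((k : ℝ) + 1)) (by positivity)
    exact ⟨N, hN, X, hX⟩
  obtain ⟨φ, hφ, hP⟩ := extraction_forall_of_frequently hfr
  choose Y hY1 hY2 using hP
  have hY0 : Tendsto (fun k => QNc (φ k) (Y k)) atTop (𝓝 u) := by
    rw [tendsto_iff_dist_tendsto_zero]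
    exact squeeze_zero (fun _ => dist_nonneg) (fun k => (hY1 k).le) tendsto_one_div_add_atTop_nhds_zero_nat
  have hend : ∀ p : Set.Icc (0:ℝ) 1, (∀ N X, QNc N X p = 0) → u p = 0 := by
    intro p hp
    have := ((continuous_eval_const (F := CI6) p).tendsto u).comp hY0
    refine tendsto_nhds_unique this ?_
    simp [Function.comp_def, hp]
  have hs := samp_tendsto6 u (fun h => hend _ fun N X => QNc_zero6 N X h)
    (fun h => hend _ fun N X => QNc_one6 N X h)
  have hex : ∀ N, ∃ X, (∀ k, φ k = N → dist (QNc N X) u < 1 / ((k : ℝ) + 1) ∧ ε < |G N X|) ∧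
      ((∀ k, φ k ≠ N) → X = samp6 u N) := by
    intro N
    by_cases hk : ∃ k, φ k = N
    · obtain ⟨k, rfl⟩ := hk
      refine ⟨Y k, fun j hj => ?_, fun hj => absurd rfl (hj k)⟩
      rw [hφ.injective hj]
      exact ⟨hY1 k, hY2 k⟩
    · push Not at hk
      exact ⟨samp6 u N, fun k h => absurd h (hk k), fun _ => rfl⟩
  choose XN hX1 hX2 using hex
  have hlim : Tendsto (fun N => dist (QNc N (XN N)) u) atTop (𝓝 0) := by
    rw [Metric.tendsto_atTop] at hs ⊢
    intro δ hδ
    obtain ⟨m, hm⟩ := hs δ hδ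
    obtain ⟨k₀, hk₀⟩ := exists_nat_one_div_lt hδ
    refine ⟨max m (φ k₀), fun N hN => ?_⟩
    by_cases hk : ∃ k, φ k = N
    · obtain ⟨k, rfl⟩ := hk
      have hkk : k₀ ≤ k := hφ.le_iff_le.1 ((le_max_right _ _).trans hN)
      rw [dist_zero_right, Real.norm_eq_abs, abs_of_nonneg dist_nonneg]
      refine ((hX1 _ k rfl).1.trans_le ?_).trans hk₀
      exact Nat.one_div_le_one_div hkk
    · push Not at hk
      rw [hX2 N hk]
      exact hm N ((le_max_left _ _).trans hN)
  have h0 := ((hG XN u hlim).comp hφ.tendsto_atTop).abs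
  rw [abs_zero] at h0
  obtain ⟨k, hk⟩ := (h0.eventually_lt_const hε).exists
  exact absurd (hX1 _ k rfl).2 (not_lt.2 hk.le)

/-- Convergence of the mixtures of the regenerative measures
in the mesoscopic-to-macroscopic limit: if `ν_N ∘ Q_N⁻¹ ⇒ ν`, and the kernels
`Rᴺ` on `ℝ^{N−1}` converge along `Q_N`-convergent sequences to the weakly
continuous kernel `R` on `C_0((0,1))`, then
`R̃ᴺ(ν_N) ∘ Q_N⁻¹ ⇒ R̃(ν)`. -/
theorem stmt6
    (νN : (N : ℕ) → Measure (Fin (N - 1) → ℝ)) (hνN : ∀ N, IsProbabilityMeasure (νN N))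
    (ν : Measure C(Set.Icc (0:ℝ) 1, ℝ)) (hν : IsProbabilityMeasure ν)
    (hνsupp : ν {f : C(Set.Icc (0:ℝ) 1, ℝ) |
      f ⟨0, by norm_num⟩ = 0 ∧ f ⟨1, by norm_num⟩ = 0} = 1)
    (hνconv : WeakConv (fun N => (νN N).map (QNc N)) ν)
    (RN : (N : ℕ) → (Fin (N - 1) → ℝ) → Measure (Fin (N - 1) → ℝ))
    (hRNmeas : ∀ N, Measurable (RN N))
    (hRNprob : ∀ N X, IsProbabilityMeasure (RN N X))
    (R : C(Set.Icc (0:ℝ) 1, ℝ) → Measure C(Set.Icc (0:ℝ) 1, ℝ))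
    (hRprob : ∀ u, IsProbabilityMeasure (R u))
    (hRsupp : ∀ u : C(Set.Icc (0:ℝ) 1, ℝ),
      u ⟨0, by norm_num⟩ = 0 → u ⟨1, by norm_num⟩ = 0 →
      R u {f : C(Set.Icc (0:ℝ) 1, ℝ) |
        f ⟨0, by norm_num⟩ = 0 ∧ f ⟨1, by norm_num⟩ = 0} = 1)
    -- continuity of `R` for the topology of weak convergence:
    (hRcont : ∀ (useq : ℕ → C(Set.Icc (0:ℝ) 1, ℝ)) (u : C(Set.Icc (0:ℝ) 1, ℝ)),
      Tendsto useq atTop (nhds u) → WeakConv (fun m => R (useq m)) (R u))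
    -- convergence of the kernels `Rᴺ` to `R` along `Q_N`-convergent sequences:
    (hRconv : ∀ (XN : (N : ℕ) → Fin (N - 1) → ℝ) (u : C(Set.Icc (0:ℝ) 1, ℝ)),
      Tendsto (fun N => ‖QNc N (XN N) - u‖) atTop (nhds 0) →
      WeakConv (fun N => (RN N (XN N)).map (QNc N)) (R u)) :
    WeakConv (fun N => ((νN N).bind (RN N)).map (QNc N)) (ν.bind R) := by
  intro φ
  have hRm : Measurable R := measurable_of_weak6 R hRprob hRcont
  have hQm : ∀ N, Measurable (QNc N) := fun N => (continuous_QNc6 N).measurable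
  have hbd : ∀ (μ : Measure C(Set.Icc (0:ℝ) 1, ℝ)) [IsProbabilityMeasure μ],
      |∫ x, φ x ∂μ| ≤ ‖φ‖ := by
    intro μ _
    simpa using φ.norm_integral_le_norm μ
  have hmp : ∀ N X, IsProbabilityMeasure ((RN N X).map (QNc N)) := fun N X =>
    Measure.isProbabilityMeasure_map (hQm N).aemeasurable
  let F : BoundedContinuousFunction C(Set.Icc (0:ℝ) 1, ℝ) ℝ :=
    BoundedContinuousFunction.ofNormedAddCommGroup (fun u => ∫ x, φ x ∂(R u))
      (continuous_iff_seqContinuous.2 fun us u hu => hRcont us u hu φ) ‖φ‖ (fun u => hbd (R u))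
  have hF : ∀ u, F u = ∫ x, φ x ∂(R u) := fun _ => rfl
  -- the mixture integrals
  have e1 : ∫ x, φ x ∂(ν.bind R) = ∫ u, F u ∂ν := by
    have : IsProbabilityMeasure (ν.bind R) := 
      isProbabilityMeasure_bind hRm.aemeasurable (Eventually.of_forall hRprob)
    exact integral_bind6 ν R hRm φ (φ.integrable _)
  let FN : (N : ℕ) → (Fin (N - 1) → ℝ) → ℝ := fun N X => ∫ x, φ x ∂((RN N X).map (QNc N))
  have hFN : ∀ N X, FN N X = ∫ y, φ (QNc N y) ∂(RN N X) := fun N X =>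
    integral_map (hQm N).aemeasurable φ.continuous.aestronglyMeasurable
  have hFNm : ∀ N, StronglyMeasurable (FN N) := by
    intro N
    have h1 : StronglyMeasurable (fun y => φ (QNc N y)) :=
      (φ.continuous.comp (continuous_QNc6 N)).stronglyMeasurable
    have := h1.integral_kernel
      (κ := (⟨RN N, hRNmeas N⟩ : ProbabilityTheory.Kernel (Fin (N - 1) → ℝ) (Fin (N - 1) → ℝ)))
    convert this using 2 with X
    exact hFN N X
  have e2 : ∀ N, ∫ x, φ x ∂(((νN N).bind (RN N)).map (QNc N)) = ∫ X, FN N X ∂(νN N) := by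
    intro N
    have : IsProbabilityMeasure ((νN N).bind (RN N)) :=
      isProbabilityMeasure_bind (hRNmeas N).aemeasurable (Eventually.of_forall (hRNprob N))
    rw [integral_map (hQm N).aemeasurable φ.continuous.aestronglyMeasurable,
      integral_bind6 (νN N) (RN N) (hRNmeas N)]
    · simp only [hFN]
    · exact (φ.compContinuous ⟨QNc N, continuous_QNc6 N⟩).integrable _
  have e3 : ∀ N, ∫ u, F u ∂((νN N).map (QNc N)) = ∫ X, F (QNc N X) ∂(νN N) := fun N =>
    integral_map (hQm N).aemeasurable F.continuous.aestronglyMeasurable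
  have hk := key6 νN hνN ν hν hνconv (fun N X => FN N X - F (QNc N X)) (‖φ‖ + ‖φ‖) (by positivity)
    (fun N X => (abs_sub _ _).trans (add_le_add (hbd _) (hbd (R _))))
    (local6 _ (fun XN u hu => by
      have h1 := hRconv XN u (by simpa only [dist_eq_norm] using hu) φ
      have h2 := (F.continuous.tendsto u).comp (tendsto_iff_dist_tendsto_zero.2 hu)
      have := h1.sub h2
      rw [hF, sub_self] at this
      exact this))
  have hsum := hk.add (hνconv F)
  rw [zero_add] at hsum
  rw [e1]
  refine hsum.congr fun N => ?_
  rw [e2, e3, integral_sub, sub_add_cancel]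
  · exact Integrable.of_bound (hFNm N).aestronglyMeasurable ‖φ‖
      (Eventually.of_forall fun X => hbd _)
  · exact (F.compContinuous ⟨QNc N, continuous_QNc6 N⟩).integrable _
end

section
/- Fix N ≥ 2, α ≥ 0, and functions σ, f, g : {1,…,N−1} × [0,∞) → [0,∞) each Lipschitz continuous in the second argument. Let F : ℝ^{N−1} → ℝ be smooth with compact support such that for each k ∈ {1,…,N−1}, ∂F/∂y_k(y) = 0 whenever y_k = 0. Define, for n ≥ 1 and y ∈ [0,∞)^{N−1}, A_nF(y) := Σ_{k=1}^{N−1} [ (1/2)·Δ²_{n,k}F(y)·1{y_k ≥ 1/√n}·σ(k,y_k)² + √n·Δ^r_{n,k}F(y)·σ(k,y_k)²·1{y_k = 0} + Δ^r_{n,k}F(y)·f(k,y_k) − Δ^l_{n,k}F(y)·g(k,y_k)·1{y_k ≥ 1/√n} + α·( Δ^r_{n,k−1}F(y − e_k/√n) + Δ^r_{n,k+1}F(y − e_k/√n) − 2Δ^l_{n,k}F(y) )·y_k ], and AF(y) := Σ_{k=1}^{N−1} [ (1/2)·σ(k,y_k)²·∂²F/∂y_k²(y) + ( f(k,y_k)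 − g(k,y_k) + α·(y_{k+1} + y_{k−1} − 2y_k) )·∂F/∂y_k(y) ], with the conventions y_0 = y_N = 0 and Δ^r_{n,0}F = Δ^r_{n,N}F = 0. Then sup over y ∈ (n^{−1/2}ℕ)^{N−1} of |A_nF(y) − AF(y)| tends to 0 as n → ∞. -/
open Filter

/-- Scaled right difference `Δʳ_{n,k}F(y) = √n·(F(y + e_k/√n) − F(y))` for
`k ∈ {1,…,m}` (coordinate `k` of the book is coordinate `k−1` of `Fin m`);
by convention it is `0` for `k = 0` or `k > m`. -/
noncomputable def dR (m n : ℕ) (F : (Fin m → ℝ) → ℝ) (k : ℕ) (y : Fin m → ℝ) : ℝ :=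
  if h : 1 ≤ k ∧ k ≤ m then
    Real.sqrt n *
      (F (y + (Real.sqrt n)⁻¹ • (Pi.single (⟨k - 1, by omega⟩ : Fin m) (1:ℝ) : Fin m → ℝ)) - F y)
  else 0

/-- Scaled left difference `Δˡ_{n,k}F(y) = √n·(F(y) − F(y − e_k/√n))`. -/
noncomputable def dL (m n : ℕ) (F : (Fin m → ℝ) → ℝ) (k : ℕ) (y : Fin m → ℝ) : ℝ :=
  if h : 1 ≤ k ∧ k ≤ m then
    Real.sqrt n *
      (F y - F (y - (Real.sqrt n)⁻¹ • (Pi.single (⟨k - 1, by omega⟩ : Fin m) (1:ℝ) : Fin m → ℝ)))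
  else 0

/-- Scaled second difference `Δ²_{n,k}F(y) = n·(F(y + e_k/√n) + F(y − e_k/√n) − 2F(y))`. -/
noncomputable def d2 (m n : ℕ) (F : (Fin m → ℝ) → ℝ) (k : ℕ) (y : Fin m → ℝ) : ℝ :=
  if h : 1 ≤ k ∧ k ≤ m then
    (n : ℝ) *
      (F (y + (Real.sqrt n)⁻¹ • (Pi.single (⟨k - 1, by omega⟩ : Fin m) (1:ℝ) : Fin m → ℝ)) +
        F (y - (Real.sqrt n)⁻¹ • (Pi.single (⟨k - 1, by omega⟩ : Fin m) (1:ℝ) : Fin m → ℝ)) - 2 * F y)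
  else 0

/-- The `k`-th coordinate `y_k` of `y`, with the conventions `y_0 = y_{m+1} = 0`. -/
def coordv (m : ℕ) (y : Fin m → ℝ) (k : ℕ) : ℝ :=
  if h : 1 ≤ k ∧ k ≤ m then y ⟨k - 1, by omega⟩ else 0

/-- The partial derivative `∂F/∂y_k`, with the conventions `∂F/∂y_0 = ∂F/∂y_{m+1} = 0`. -/
noncomputable def pd1 (m : ℕ) (F : (Fin m → ℝ) → ℝ) (k : ℕ) (y : Fin m → ℝ) : ℝ :=
  if h : 1 ≤ k ∧ k ≤ m then
    fderiv ℝ F y ((Pi.single (⟨k - 1, by omega⟩ : Fin m) (1:ℝ) : Fin m → ℝ))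
  else 0

/-- The second partial derivative `∂²F/∂y_k²`. -/
noncomputable def pd2 (m : ℕ) (F : (Fin m → ℝ) → ℝ) (k : ℕ) (y : Fin m → ℝ) : ℝ :=
  if h : 1 ≤ k ∧ k ≤ m then
    fderiv ℝ (fun z => fderiv ℝ F z ((Pi.single (⟨k - 1, by omega⟩ : Fin m) (1:ℝ) : Fin m → ℝ))) y
      ((Pi.single (⟨k - 1, by omega⟩ : Fin m) (1:ℝ) : Fin m → ℝ))
  else 0

/-- The shifted point `y − e_k/√n` (equal to `y` if `k` is out of range). -/
noncomputable def shiftDown (m n k : ℕ) (y : Fin m → ℝ) : Fin m → ℝ :=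
  if h : 1 ≤ k ∧ k ≤ m then
    y - (Real.sqrt n)⁻¹ • (Pi.single (⟨k - 1, by omega⟩ : Fin m) (1:ℝ) : Fin m → ℝ)
  else y

/-- The pre-limit generator `A_n F(y)` of the rescaled microscopic order book
process (one side of the book with `m = N − 1` active price levels). -/
noncomputable def genAn (m n : ℕ) (α : ℝ) (σ f g : ℕ → ℝ → ℝ)
    (F : (Fin m → ℝ) → ℝ) (y : Fin m → ℝ) : ℝ :=
  ∑ k ∈ Finset.Icc 1 m,
    ((1 : ℝ) / 2 * d2 m n F k y * (if (Real.sqrt n)⁻¹ ≤ coordv m y k then 1 else 0) *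
        (σ k (coordv m y k)) ^ 2
      + Real.sqrt n * dR m n F k y * (σ k (coordv m y k)) ^ 2 *
        (if coordv m y k = 0 then 1 else 0)
      + dR m n F k y * f k (coordv m y k)
      - dL m n F k y * g k (coordv m y k) *
        (if (Real.sqrt n)⁻¹ ≤ coordv m y k then 1 else 0)
      + α * (dR m n F (k - 1) (shiftDown m n k y) + dR m n F (k + 1) (shiftDown m n k y)
          - 2 * dL m n F k y) * coordv m y k)

/-- The limiting generator `A F(y)` of the system of reflected SDEs. -/
noncomputable def genA (m : ℕ) (α : ℝ) (σ f g : ℕ → ℝ → ℝ)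
    (F : (Fin m → ℝ) → ℝ) (y : Fin m → ℝ) : ℝ :=
  ∑ k ∈ Finset.Icc 1 m,
    ((1 : ℝ) / 2 * (σ k (coordv m y k)) ^ 2 * pd2 m F k y
      + (f k (coordv m y k) - g k (coordv m y k)
          + α * (coordv m y (k + 1) + coordv m y (k - 1) - 2 * coordv m y k)) *
        pd1 m F k y)

/-- Directional derivative. -/
noncomputable def DV {E : Type*} [NormedAddCommGroup E] [NormedSpace ℝ E] (v : E) (G : E → ℝ) :
    E → ℝ := fun z => fderiv ℝ G z v

/-- Test functions. -/
def TF {E : Type*} [NormedAddCommGroup E] [NormedSpace ℝ E] (G : E → ℝ) : Prop :=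
  ContDiff ℝ (⊤ : ℕ∞) G ∧ HasCompactSupport G

section taylor
variable {E : Type*} [NormedAddCommGroup E] [NormedSpace ℝ E]

theorem TF.dv {G : E → ℝ} (h : TF G) (v : E) : TF (DV v G) := by
  refine ⟨?_, h.2.fderiv_apply (𝕜 := ℝ) v⟩
  have h1 : ContDiff ℝ (⊤ : ℕ∞) (fderiv ℝ G) := h.1.fderiv_right (by simp)
  exact h1.clm_apply contDiff_const

theorem TF.bdd {G : E → ℝ} (h : TF G) : ∃ C, 0 ≤ C ∧ ∀ x, |G x| ≤ C := by
  obtain ⟨C, hC⟩ := h.2.exists_bound_of_continuous h.1.continuous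
  exact ⟨C, (norm_nonneg _).trans (hC 0), hC⟩

theorem TF.far {G : E → ℝ} (h : TF G) : ∃ R, 0 ≤ R ∧ ∀ x, R < ‖x‖ → G x = 0 := by
  obtain ⟨R, hR⟩ := h.2.isCompact.isBounded.exists_norm_le
  refine ⟨max R 0, le_max_right _ _, fun x hx => ?_⟩
  by_contra hne
  have := hR x (subset_tsupport _ hne)
  exact absurd (lt_of_le_of_lt (le_max_left R 0) hx) (not_lt.mpr this)

theorem TF.line {G : E → ℝ} (h : TF G) (y v : E) (t : ℝ) :
    HasDerivAt (fun s : ℝ => G (y + s • v)) (DV v G (y + t • v)) t := by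
  have h1 : HasFDerivAt G (fderiv ℝ G (y + t • v)) (y + t • v) :=
    ((h.1.differentiable (by simp)) _).hasFDerivAt
  have h2 : HasDerivAt (fun s : ℝ => y + s • v) v t := by
    simpa using ((hasDerivAt_id t).smul_const v).const_add y
  exact h1.comp_hasDerivAt t h2

theorem mv_pow {φ φ' : ℝ → ℝ} (hd : ∀ t, HasDerivAt φ (φ' t) t) (h0 : φ 0 = 0) {C : ℝ} (hC : 0 ≤ C)
    (k : ℕ) (hb : ∀ t, 0 ≤ t → |φ' t| ≤ C * t ^ k) (t : ℝ) (ht : 0 ≤ t) :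
    |φ t| ≤ C * t ^ (k + 1) := by
  have := Convex.norm_image_sub_le_of_norm_hasDerivWithin_le (f := φ) (f' := φ') (s := Set.Icc 0 t)
    (C := C * t ^ k) (x := 0) (y := t) (fun x _ => (hd x).hasDerivWithinAt)
    (fun x hx => (hb x hx.1).trans (by
      have := hx.1
      gcongr
      exact hx.2)) (convex_Icc _ _)
    (Set.left_mem_Icc.2 ht) (Set.right_mem_Icc.2 ht)
  rw [h0, sub_zero, sub_zero, Real.norm_eq_abs, Real.norm_eq_abs, abs_of_nonneg ht] at this
  rw [pow_succ, ← mul_assoc]; exact this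

theorem TF.t0 {G : E → ℝ} (h : TF G) (v : E) :
    ∃ C, 0 ≤ C ∧ ∀ y t, 0 ≤ t → |G (y + t • v) - G y| ≤ C * t := by
  obtain ⟨C, hC, hb⟩ := (h.dv v).bdd
  refine ⟨C, hC, fun y t ht => ?_⟩
  have := mv_pow (φ := fun s => G (y + s • v) - G y) (fun s => (h.line y v s).sub_const _)
    (by simp) hC 0 (fun s _ => by simpa using hb _) t ht
  simpa using this

theorem TF.t1 {G : E → ℝ} (h : TF G) (v : E) :
    ∃ C, 0 ≤ C ∧ ∀ y t, 0 ≤ t → |G (y + t • v) - G y - t * DV v G y| ≤ C * t ^ 2 := by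
  obtain ⟨C, hC, hb⟩ := (h.dv v).t0 v
  refine ⟨C, hC, fun y t ht => ?_⟩
  exact mv_pow (φ := fun s => G (y + s • v) - G y - s * DV v G y)
    (φ' := fun s => DV v G (y + s • v) - DV v G y)
    (fun s => by
      have h1 := ((h.line y v s).sub_const (G y)).sub ((hasDerivAt_id s).mul_const (DV v G y))
      rw [one_mul] at h1
      exact h1)
    (by simp) hC 1 (fun s hs => by simpa using hb y s hs) t ht

theorem TF.t2 {G : E → ℝ} (h : TF G) (v : E) :
    ∃ C, 0 ≤ C ∧ ∀ y t, 0 ≤ t →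
      |G (y + t • v) - G y - t * DV v G y - t ^ 2 / 2 * DV v (DV v G) y| ≤ C * t ^ 3 := by
  obtain ⟨C, hC, hb⟩ := (h.dv v).t1 v
  refine ⟨C, hC, fun y t ht => ?_⟩
  exact mv_pow (φ := fun s => G (y + s • v) - G y - s * DV v G y - s ^ 2 / 2 * DV v (DV v G) y)
    (φ' := fun s => DV v G (y + s • v) - DV v G y - s * DV v (DV v G) y)
    (fun s => by
      have h2 : HasDerivAt (fun s : ℝ => s ^ 2 / 2) s s := by
        simpa using (hasDerivAt_pow 2 s).div_const 2
      have h1 := (((h.line y v s).sub_const (G y)).sub ((hasDerivAt_id s).mul_const (DV v G y))).sub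
        (h2.mul_const (DV v (DV v G) y))
      rw [one_mul] at h1
      exact h1)
    (by simp) hC 2 (fun s hs => by simpa using hb y s hs) t ht

theorem DV_neg (v : E) (G : E → ℝ) (y : E) : DV (-v) G y = - DV v G y := by
  simp [DV]

theorem DV_neg2 (v : E) (G : E → ℝ) (y : E) : DV (-v) (DV (-v) G) y = DV v (DV v G) y := by
  have : DV (-v) G = fun z => - DV v G z := by ext z; simp [DV]
  rw [this, DV_neg]
  have h2 : fderiv ℝ (fun z => - DV v G z) y = - fderiv ℝ (DV v G) y := fderiv_fun_neg
  change -(fderiv ℝ (fun z => - DV v G z) y v) = fderiv ℝ (DV v G) y v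
  rw [h2]
  simp

end taylor

/-- Lattice points. -/
def OBLat (m n : ℕ) (y : Fin m → ℝ) : Prop := ∀ i, ∃ j : ℕ, y i = (j : ℝ) / Real.sqrt n

/-- Errors of order `n^{-1/2}` vanishing for large `y`. -/
def Good (m : ℕ) (q : ℕ → (Fin m → ℝ) → ℝ) : Prop :=
  ∃ C B : ℝ, 0 ≤ C ∧ ∀ n : ℕ, 1 ≤ n → ∀ y, OBLat m n y →
    |q n y| ≤ C * (Real.sqrt n)⁻¹ ∧ (B < ‖y‖ → q n y = 0)

/-- Locally bounded coefficients. -/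
def LocB (m : ℕ) (c : ℕ → (Fin m → ℝ) → ℝ) : Prop :=
  ∀ B : ℝ, ∃ K : ℝ, 0 ≤ K ∧ ∀ n : ℕ, 1 ≤ n → ∀ y, OBLat m n y → ‖y‖ ≤ B → |c n y| ≤ K

theorem Good.add {m : ℕ} {p q : ℕ → (Fin m → ℝ) → ℝ} (hp : Good m p) (hq : Good m q) :
    Good m (fun n y => p n y + q n y) := by
  obtain ⟨C, B, hC, h⟩ := hp
  obtain ⟨C', B', hC', h'⟩ := hq
  refine ⟨C + C', max B B', by positivity, fun n hn y hy => ⟨?_, fun hB => ?_⟩⟩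
  · have h1 := (h n hn y hy).1
    have h2 := (h' n hn y hy).1
    have := abs_add_le (p n y) (q n y)
    linarith
  · beta_reduce
    rw [(h n hn y hy).2 ((le_max_left _ _).trans_lt hB),
      (h' n hn y hy).2 ((le_max_right _ _).trans_lt hB), add_zero]

theorem Good.mul {m : ℕ} {p c : ℕ → (Fin m → ℝ) → ℝ} (hc : LocB m c) (hp : Good m p) :
    Good m (fun n y => c n y * p n y) := by
  obtain ⟨C, B, hC, h⟩ := hp
  obtain ⟨K, hK, hk⟩ := hc B
  refine ⟨K * C, B, by positivity, fun n hn y hy => ⟨?_, fun hB => ?_⟩⟩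
  · by_cases hB : B < ‖y‖
    · beta_reduce
      rw [(h n hn y hy).2 hB, mul_zero, abs_zero]; positivity
    · rw [abs_mul, mul_assoc]
      exact mul_le_mul (hk n hn y hy (not_lt.1 hB)) (h n hn y hy).1 (abs_nonneg _) hK
  · beta_reduce
    rw [(h n hn y hy).2 hB, mul_zero]

theorem LocB.const {m : ℕ} (a : ℝ) : LocB m (fun _ _ => a) :=
  fun _ => ⟨|a|, abs_nonneg _, fun _ _ _ _ _ => le_rfl⟩

theorem LocB.mul {m : ℕ} {c d : ℕ → (Fin m → ℝ) → ℝ} (hc : LocB m c) (hd : LocB m d) :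
    LocB m (fun n y => c n y * d n y) := by
  intro B
  obtain ⟨K, hK, h⟩ := hc B
  obtain ⟨K', hK', h'⟩ := hd B
  refine ⟨K * K', by positivity, fun n hn y hy hB => ?_⟩
  rw [abs_mul]
  exact mul_le_mul (h n hn y hy hB) (h' n hn y hy hB) (abs_nonneg _) hK

theorem LocB.coord {m : ℕ} (i : Fin m) : LocB m (fun _ y => y i) :=
  fun B => ⟨max B 0, le_max_right _ _, fun _ _ y _ hB =>
    (norm_le_pi_norm y i).trans (hB.trans (le_max_left _ _))⟩

theorem OBLat.nonneg {m n : ℕ} {y : Fin m → ℝ} (h : OBLat m n y) (i : Fin m) : 0 ≤ y i := by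
  obtain ⟨j, hj⟩ := h i
  rw [hj]; positivity

theorem OBLat.cases {m n : ℕ} {y : Fin m → ℝ} (h : OBLat m n y) (i : Fin m) :
    y i = 0 ∨ (Real.sqrt n)⁻¹ ≤ y i := by
  obtain ⟨j, hj⟩ := h i
  rcases Nat.eq_zero_or_pos j with h0 | h0
  · left; simp [hj, h0]
  · right
    have : (1 : ℝ) ≤ j := by exact_mod_cast h0
    rw [hj, div_eq_mul_inv]
    exact le_mul_of_one_le_left (by positivity) this

theorem LocB.lip {m : ℕ} {f : ℝ → ℝ} (hf : ∃ L : NNReal, LipschitzOnWith L f (Set.Ici 0))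
    (i : Fin m) : LocB m (fun _ y => f (y i)) := by
  obtain ⟨L, hL⟩ := hf
  intro B
  refine ⟨|f 0| + L * max B 0, by positivity, fun n hn y hy hB => ?_⟩
  have h0 := hy.nonneg i
  have h1 := hL.dist_le_mul (y i) h0 0 (Set.mem_Ici.2 le_rfl)
  rw [Real.dist_eq, Real.dist_eq, sub_zero] at h1
  have h2 : |y i| ≤ max B 0 := (norm_le_pi_norm y i).trans (hB.trans (le_max_left _ _))
  have h3 : (L : ℝ) * |y i| ≤ L * max B 0 := by gcongr
  have h4 : |f (y i)| ≤ |f (y i) - f 0| + |f 0| := by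
    simpa using abs_add_le (f (y i) - f 0) (f 0)
  linarith

theorem Good.sum {m : ℕ} (s : Finset ℕ) {q : ℕ → ℕ → (Fin m → ℝ) → ℝ}
    (h : ∀ k ∈ s, Good m (q k)) : Good m (fun n y => ∑ k ∈ s, q k n y) := by
  classical
  induction s using Finset.induction_on with
  | empty => exact ⟨0, 0, le_rfl, fun n _ y _ => by simp⟩
  | insert a s ha ih =>
    simp only [Finset.sum_insert ha]
    exact (h a (by simp)).add (ih fun k hk => h k (by simp [hk]))

theorem sum_shift (m : ℕ) (a b : ℕ → ℝ) (ha : a 0 = 0) (hb : b (m + 1) = 0) :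
    ∑ k ∈ Finset.Icc 1 m, a k * b (k + 1) = ∑ k ∈ Finset.Icc 1 m, a (k - 1) * b k := by
  have conv : ∀ u : ℕ → ℝ, ∑ k ∈ Finset.Icc 1 m, u k = ∑ i ∈ Finset.range m, u (i + 1) := by
    intro u
    rw [Finset.range_eq_Ico, Finset.sum_Ico_add' u 0 m 1]
    rfl
  rw [conv, conv]
  have h1 := Finset.sum_range_succ (fun i => a i * b (i + 1)) m
  have h2 := Finset.sum_range_succ' (fun i => a i * b (i + 1)) m
  simp only [ha, hb, zero_mul, mul_zero, add_zero] at h1 h2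
  simp only [Nat.add_sub_cancel]
  rw [← h1, h2]

theorem TF.far' {E : Type*} [NormedAddCommGroup E] [NormedSpace ℝ E] {G : E → ℝ} (h : TF G) :
    ∃ R, 0 ≤ R ∧ ∀ x w, ‖w‖ ≤ 2 → R < ‖x‖ → G (x + w) = 0 := by
  obtain ⟨R, hR, h⟩ := h.far
  refine ⟨R + 2, by positivity, fun x w hw hx => h _ ?_⟩
  have : ‖x‖ ≤ ‖x + w‖ + ‖w‖ := by simpa using norm_sub_le (x + w) w
  linarith

theorem sqrt_facts {n : ℕ} (hn : 1 ≤ n) : ∃ h : ℝ, h = (Real.sqrt n)⁻¹ ∧ 0 < h ∧ h ≤ 1 ∧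
    Real.sqrt n = h⁻¹ ∧ (n : ℝ) = (h ^ 2)⁻¹ := by
  have h1 : (1 : ℝ) ≤ n := by exact_mod_cast hn
  have h2 : 1 ≤ Real.sqrt n := Real.one_le_sqrt.2 h1
  refine ⟨_, rfl, by positivity, inv_le_one_of_one_le₀ h2, by simp, ?_⟩
  rw [inv_pow, Real.sq_sqrt (by positivity), inv_inv]

theorem norm_hs {m : ℕ} (i : Fin m) {h : ℝ} (h0 : 0 < h) (h1 : h ≤ 1) :
    ‖h • (Pi.single i (1:ℝ) : Fin m → ℝ)‖ ≤ 1 := by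
  rw [norm_smul, Pi.norm_single, Real.norm_eq_abs, abs_of_pos h0]
  simpa using h1

/-- dividing an error by a power of the step -/
theorem div_err {h a D C : ℝ} (k : ℕ) (h0 : 0 < h) (H : |a - h ^ k * D| ≤ C * h ^ (k + 1)) :
    |(h ^ k)⁻¹ * a - D| ≤ C * h := by
  have e : (h ^ k)⁻¹ * a - D = (h ^ k)⁻¹ * (a - h ^ k * D) := by field_simp
  rw [e, abs_mul, abs_of_pos (by positivity)]
  calc (h ^ k)⁻¹ * |a - h ^ k * D| ≤ (h ^ k)⁻¹ * (C * h ^ (k + 1)) := by gcongr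
    _ = C * h := by rw [pow_succ]; field_simp

theorem aux_one {X D h C : ℝ} (H : |X - h * 0 - h ^ 2 / 2 * D| ≤ C * h ^ 3) :
    |2 * X - h ^ 2 * D| ≤ 2 * C * h ^ (2 + 1) := by
  norm_num at H ⊢
  rw [abs_le] at H ⊢
  constructor <;> linarith

theorem aux_two {a b c d D h C C' : ℝ} (H : |a - c - h * d - h ^ 2 / 2 * D| ≤ C * h ^ 3)
    (H' : |b - c - h * -d - h ^ 2 / 2 * D| ≤ C' * h ^ 3) :
    |a + b - 2 * c - h ^ 2 * D| ≤ (C + C') * h ^ (2 + 1) := by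
  norm_num at H H' ⊢
  rw [abs_le] at H H' ⊢
  constructor <;> linarith

section q
variable {m : ℕ} {F : (Fin m → ℝ) → ℝ}

theorem good_R (hF : TF F) (i : Fin m) :
    Good m (fun n y => Real.sqrt n * (F (y + (Real.sqrt n)⁻¹ • (Pi.single i (1:ℝ) : Fin m → ℝ)) - F y)
      - DV (Pi.single i (1:ℝ)) F y) := by
  obtain ⟨C, hC, hb⟩ := hF.t1 (Pi.single i (1:ℝ))
  obtain ⟨R, hR, hf⟩ := hF.far'
  obtain ⟨R', hR', hf'⟩ := (hF.dv (Pi.single i (1:ℝ))).far'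
  refine ⟨C, max R R', hC, fun n hn y hy => ?_⟩
  obtain ⟨h, e, h0, h1, es, en⟩ := sqrt_facts hn
  beta_reduce
  rw [← e, es]
  refine ⟨?_, fun hB => ?_⟩
  · have := div_err 1 h0 (a := F (y + h • Pi.single i (1:ℝ)) - F y) (C := C) (by
      simpa using hb y h h0.le)
    simpa using this
  · have a1 := hf y (h • Pi.single i (1:ℝ)) (by linarith [norm_hs i h0 h1])
      ((le_max_left _ _).trans_lt hB)
    have a2 := hf y 0 (by simp) ((le_max_left _ _).trans_lt hB)
    have a3 := hf' y 0 (by simp) ((le_max_right _ _).trans_lt hB)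
    rw [add_zero] at a2 a3
    rw [a1, a2, a3]; simp

theorem good_L (hF : TF F) (i : Fin m) :
    Good m (fun n y => Real.sqrt n * (F y - F (y - (Real.sqrt n)⁻¹ • (Pi.single i (1:ℝ) : Fin m → ℝ)))
      - DV (Pi.single i (1:ℝ)) F y) := by
  obtain ⟨C, hC, hb⟩ := hF.t1 (-Pi.single i (1:ℝ))
  obtain ⟨R, hR, hf⟩ := hF.far'
  obtain ⟨R', hR', hf'⟩ := (hF.dv (Pi.single i (1:ℝ))).far'
  refine ⟨C, max R R', hC, fun n hn y hy => ?_⟩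
  obtain ⟨h, e, h0, h1, es, en⟩ := sqrt_facts hn
  beta_reduce
  rw [← e, es]
  refine ⟨?_, fun hB => ?_⟩
  · have := div_err 1 h0 (a := F y - F (y - h • Pi.single i (1:ℝ)))
      (D := DV (Pi.single i (1:ℝ)) F y) (C := C) (by
        have := hb y h h0.le
        rw [DV_neg, smul_neg, ← sub_eq_add_neg, ← abs_neg] at this
        convert this using 2
        ring)
    simpa using this
  · have a1 := hf y (-(h • Pi.single i (1:ℝ))) (by rw [norm_neg]; linarith [norm_hs i h0 h1])
      ((le_max_left _ _).trans_lt hB)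
    have a2 := hf y 0 (by simp) ((le_max_left _ _).trans_lt hB)
    have a3 := hf' y 0 (by simp) ((le_max_right _ _).trans_lt hB)
    rw [add_zero] at a2 a3
    rw [sub_eq_add_neg y, a1, a2, a3]; simp

theorem good_S (hF : TF F) (i j : Fin m) :
    Good m (fun n y => Real.sqrt n *
      (F (y - (Real.sqrt n)⁻¹ • (Pi.single i (1:ℝ) : Fin m → ℝ)
          + (Real.sqrt n)⁻¹ • (Pi.single j (1:ℝ) : Fin m → ℝ))
        - F (y - (Real.sqrt n)⁻¹ • (Pi.single i (1:ℝ) : Fin m → ℝ)))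
      - DV (Pi.single j (1:ℝ)) F y) := by
  obtain ⟨C, hC, hb⟩ := hF.t1 (Pi.single j (1:ℝ))
  obtain ⟨C', hC', hb'⟩ := (hF.dv (Pi.single j (1:ℝ))).t0 (-Pi.single i (1:ℝ))
  obtain ⟨R, hR, hf⟩ := hF.far'
  obtain ⟨R', hR', hf'⟩ := (hF.dv (Pi.single j (1:ℝ))).far'
  refine ⟨C + C', max R R', by positivity, fun n hn y hy => ?_⟩
  obtain ⟨h, e, h0, h1, es, en⟩ := sqrt_facts hn
  beta_reduce
  rw [← e, es]
  refine ⟨?_, fun hB => ?_⟩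
  · have b1 := div_err 1 h0 (a := F (y - h • Pi.single i (1:ℝ) + h • Pi.single j (1:ℝ))
        - F (y - h • Pi.single i (1:ℝ)))
      (C := C) (by simpa using hb (y - h • Pi.single i (1:ℝ)) h h0.le)
    have b2 := hb' y h h0.le
    rw [smul_neg, ← sub_eq_add_neg] at b2
    rw [pow_one] at b1
    have b3 := abs_add_le _ _ |>.trans (add_le_add b1 b2)
    rw [sub_add_sub_cancel] at b3
    linarith
  · have n1 := norm_hs i h0 h1
    have n2 := norm_hs j h0 h1
    have a1 := hf y (-(h • Pi.single i (1:ℝ))) (by rw [norm_neg]; linarith)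
      ((le_max_left _ _).trans_lt hB)
    have a2 := hf y (-(h • Pi.single i (1:ℝ)) + h • Pi.single j (1:ℝ))
      ((norm_add_le _ _).trans (by rw [norm_neg]; linarith)) ((le_max_left _ _).trans_lt hB)
    have a3 := hf' y 0 (by simp) ((le_max_right _ _).trans_lt hB)
    rw [add_zero] at a3
    rw [← add_assoc] at a2
    rw [sub_eq_add_neg y, a1, a2, a3]; simp

theorem good_L1 (hF : TF F) (i : Fin m)
    (hbd : ∀ y : Fin m → ℝ, y i = 0 → DV (Pi.single i (1:ℝ)) F y = 0) :
    Good m (fun n y => Real.sqrt n * (F y - F (y - (Real.sqrt n)⁻¹ • (Pi.single i (1:ℝ) : Fin m → ℝ)))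
      * (if (Real.sqrt n)⁻¹ ≤ y i then 1 else 0) - DV (Pi.single i (1:ℝ)) F y) := by
  obtain ⟨C, B, hC, H⟩ := good_L hF i
  refine ⟨C, B, hC, fun n hn y hy => ?_⟩
  obtain ⟨h, e, h0, h1, es, en⟩ := sqrt_facts hn
  beta_reduce
  rcases hy.cases i with hz | hz
  · have : ¬ ((Real.sqrt n)⁻¹ ≤ y i) := by rw [hz, ← e]; linarith
    rw [if_neg this, hbd y hz]
    simp; positivity
  · rw [if_pos hz, mul_one]
    exact H n hn y hy

theorem good_2 (hF : TF F) (i : Fin m) (v : Fin m → ℝ)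
    (hv : ∀ h : ℝ, 0 < h → h ≤ 1 → ‖h • v‖ ≤ 1)
    (hbd : ∀ y : Fin m → ℝ, y i = 0 → DV v F y = 0) :
    Good m (fun n y =>
      (n : ℝ) * (F (y + (Real.sqrt n)⁻¹ • v)
        + F (y - (Real.sqrt n)⁻¹ • v) - 2 * F y)
        * (if (Real.sqrt n)⁻¹ ≤ y i then 1 else 0)
      + 2 * (Real.sqrt n * (Real.sqrt n *
        (F (y + (Real.sqrt n)⁻¹ • v) - F y)))
        * (if y i = 0 then 1 else 0)
      - DV v (DV v F) y) := by
  obtain ⟨C, hC, hb⟩ := hF.t2 v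
  obtain ⟨C', hC', hb'⟩ := hF.t2 (-v)
  obtain ⟨R, hR, hf⟩ := hF.far'
  obtain ⟨R', hR', hf'⟩ := ((hF.dv v).dv v).far'
  refine ⟨2 * C + C', max R R', by positivity, fun n hn y hy => ?_⟩
  obtain ⟨h, e, h0, h1, es, en⟩ := sqrt_facts hn
  beta_reduce
  rw [← e, es, en]
  refine ⟨?_, fun hB => ?_⟩
  · have b1 := hb y h h0.le
    have b2 := hb' y h h0.le
    rw [DV_neg, DV_neg2, smul_neg, ← sub_eq_add_neg] at b2
    rcases hy.cases i with hz | hz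
    · have : ¬ (h ≤ y i) := by rw [hz]; linarith
      rw [if_neg this, if_pos hz]
      rw [hbd y hz] at b1
      have := div_err 2 h0 (a := 2 * (F (y + h • v) - F y))
        (D := DV v (DV v F) y) (C := 2 * C) (aux_one b1)
      have e2 : ∀ X D : ℝ, 0 + 2 * (h⁻¹ * (h⁻¹ * X)) * 1 - D = (h ^ 2)⁻¹ * (2 * X) - D := by
        intro X D; rw [pow_two, mul_inv]; ring
      rw [mul_zero, e2]
      refine this.trans ?_
      gcongr
      linarith
    · rw [← e] at hz
      have : ¬ (y i = 0) := by linarith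
      rw [if_neg this, if_pos hz, mul_zero, mul_one, add_zero]
      refine (div_err 2 h0 (C := C + C') ?_).trans ?_
      · exact aux_two b1 b2
      · gcongr
        linarith
  · have n1 := hv h h0 h1
    have a0 := hf y 0 (by simp) ((le_max_left _ _).trans_lt hB)
    have a1 := hf y (-(h • v)) (by rw [norm_neg]; linarith)
      ((le_max_left _ _).trans_lt hB)
    have a2 := hf y (h • v) (by linarith) ((le_max_left _ _).trans_lt hB)
    have a3 := hf' y 0 (by simp) ((le_max_right _ _).trans_lt hB)
    rw [add_zero] at a3 a0
    rw [sub_eq_add_neg y, a1, a2, a3, a0]; simp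

theorem good_Sk (hF : TF F) (i : Fin m) (k : ℕ) :
    Good m (fun n y => dR m n F k (y - (Real.sqrt n)⁻¹ • (Pi.single i (1:ℝ) : Fin m → ℝ))
      - pd1 m F k y) := by
  by_cases hk : 1 ≤ k ∧ k ≤ m
  · simp only [dR, pd1, dif_pos hk]
    exact good_S hF i _
  · simp only [dR, pd1, dif_neg hk]
    exact ⟨0, 0, le_rfl, fun n _ y _ => by simp⟩

end q

/-- The `k`-th error term. -/
noncomputable def errT (m : ℕ) (α : ℝ) (σ f g : ℕ → ℝ → ℝ)
    (F : (Fin m → ℝ) → ℝ) (k n : ℕ) (y : Fin m → ℝ) : ℝ :=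
    ((1 : ℝ) / 2 * d2 m n F k y * (if (Real.sqrt n)⁻¹ ≤ coordv m y k then 1 else 0) *
        (σ k (coordv m y k)) ^ 2
      + Real.sqrt n * dR m n F k y * (σ k (coordv m y k)) ^ 2 *
        (if coordv m y k = 0 then 1 else 0)
      + dR m n F k y * f k (coordv m y k)
      - dL m n F k y * g k (coordv m y k) *
        (if (Real.sqrt n)⁻¹ ≤ coordv m y k then 1 else 0)
      + α * (dR m n F (k - 1) (shiftDown m n k y) + dR m n F (k + 1) (shiftDown m n k y)
          - 2 * dL m n F k y) * coordv m y k)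
    - ((1 : ℝ) / 2 * (σ k (coordv m y k)) ^ 2 * pd2 m F k y
      + (f k (coordv m y k) - g k (coordv m y k)) * pd1 m F k y
      + α * (coordv m y k * (pd1 m F (k - 1) y + pd1 m F (k + 1) y - 2 * pd1 m F k y)))

theorem gen_diff (m n : ℕ) (α : ℝ) (σ f g : ℕ → ℝ → ℝ) (F : (Fin m → ℝ) → ℝ) (y : Fin m → ℝ) :
    genAn m n α σ f g F y - genA m α σ f g F y
      = ∑ k ∈ Finset.Icc 1 m, errT m α σ f g F k n y := by
  have s1 := sum_shift m (coordv m y) (fun k => pd1 m F k y) (by simp [coordv]) (by simp [pd1])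
  have s2 := sum_shift m (fun k => pd1 m F k y) (coordv m y) (by simp [pd1]) (by simp [coordv])
  have key : genA m α σ f g F y = ∑ k ∈ Finset.Icc 1 m,
      ((1 : ℝ) / 2 * (σ k (coordv m y k)) ^ 2 * pd2 m F k y
      + (f k (coordv m y k) - g k (coordv m y k)) * pd1 m F k y
      + α * (coordv m y k * (pd1 m F (k - 1) y + pd1 m F (k + 1) y - 2 * pd1 m F k y))) := by
    rw [← sub_eq_zero, genA, ← Finset.sum_sub_distrib]
    have : ∀ k ∈ Finset.Icc 1 m,
        ((1 : ℝ) / 2 * (σ k (coordv m y k)) ^ 2 * pd2 m F k y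
      + (f k (coordv m y k) - g k (coordv m y k)
          + α * (coordv m y (k + 1) + coordv m y (k - 1) - 2 * coordv m y k)) *
        pd1 m F k y) - ((1 : ℝ) / 2 * (σ k (coordv m y k)) ^ 2 * pd2 m F k y
      + (f k (coordv m y k) - g k (coordv m y k)) * pd1 m F k y
      + α * (coordv m y k * (pd1 m F (k - 1) y + pd1 m F (k + 1) y - 2 * pd1 m F k y)))
        = α * ((pd1 m F k y * coordv m y (k + 1)
        - pd1 m F (k - 1) y * coordv m y k) - (coordv m y k * pd1 m F (k + 1) y -
          coordv m y (k - 1) * pd1 m F k y)) := fun k _ => by ring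
    rw [Finset.sum_congr rfl this, ← Finset.mul_sum, Finset.sum_sub_distrib,
      Finset.sum_sub_distrib, Finset.sum_sub_distrib, s1, s2]
    simp
  rw [key, genAn, ← Finset.sum_sub_distrib]
  rfl

theorem good_err (m : ℕ) (α : ℝ) (σ f g : ℕ → ℝ → ℝ)
    (F : (Fin m → ℝ) → ℝ) (hF : TF F) (k : ℕ) (hk : 1 ≤ k ∧ k ≤ m)
    (hσ : ∃ L : NNReal, LipschitzOnWith L (σ k) (Set.Ici 0))
    (hf : ∃ L : NNReal, LipschitzOnWith L (f k) (Set.Ici 0))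
    (hg : ∃ L : NNReal, LipschitzOnWith L (g k) (Set.Ici 0))
    (hbd : ∀ (y : Fin m → ℝ) (k : Fin m), y k = 0 → fderiv ℝ F y (Pi.single k 1) = 0) :
    Good m (errT m α σ f g F k) := by
  obtain ⟨i, hi⟩ : ∃ i : Fin m, i = ⟨k - 1, by omega⟩ := ⟨_, rfl⟩
  have hs := LocB.lip (m := m) hσ i
  have G1 := Good.mul ((LocB.const (1 / 2)).mul (hs.mul hs)) (good_2 hF i _ (fun _ => norm_hs i) fun y hy => hbd y i hy)
  have G2 := Good.mul (LocB.lip hf i) (good_R hF i)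
  have G3 := Good.mul ((LocB.const (-1)).mul (LocB.lip hg i))
    (good_L1 hF i fun y hy => hbd y i hy)
  have cα := (LocB.const α).mul (LocB.coord i)
  have G4 := Good.mul cα (good_Sk hF i (k - 1))
  have G5 := Good.mul cα (good_Sk hF i (k + 1))
  have G6 := Good.mul (cα.mul (LocB.const (-2))) (good_L hF i)
  have G := ((((G1.add G2).add G3).add G4).add G5).add G6
  convert G using 3 with n y
  have c1 : coordv m y k = y i := by simp only [coordv, dif_pos hk, hi]
  have c2 : shiftDown m n k y = y - (Real.sqrt n)⁻¹ • (Pi.single i (1:ℝ) : Fin m → ℝ) := by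
    simp only [shiftDown, dif_pos hk, hi]
  have c3 : pd1 m F k y = DV (Pi.single i (1:ℝ)) F y := by
    simp only [pd1, dif_pos hk, hi, DV]
  have c4 : pd2 m F k y = DV (Pi.single i (1:ℝ)) (DV (Pi.single i (1:ℝ)) F) y := by
    simp only [pd2, dif_pos hk, hi]; rfl
  have c5 : dR m n F k y = _ := dif_pos hk
  have c6 : dL m n F k y = _ := dif_pos hk
  have c7 : d2 m n F k y = _ := dif_pos hk
  rw [← hi] at c5 c6 c7
  rw [errT, c1, c2, c3, c4, c5, c6, c7]
  ring

/-- Uniform convergence of the generators on the lattice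
`(n^{-1/2}ℕ)^{N−1}`: for `F` smooth with compact support whose `k`-th partial
derivative vanishes on `{y_k = 0}`, `sup_y |A_nF(y) − AF(y)| → 0` as `n → ∞`. -/
theorem stmt8 (N : ℕ) (hN : 2 ≤ N) (α : ℝ) (hα : 0 ≤ α)
    (σ f g : ℕ → ℝ → ℝ)
    (hσ_lip : ∀ k : ℕ, 1 ≤ k → k ≤ N - 1 → ∃ L : NNReal, LipschitzOnWith L (σ k) (Set.Ici 0))
    (hf_lip : ∀ k : ℕ, 1 ≤ k → k ≤ N - 1 → ∃ L : NNReal, LipschitzOnWith L (f k) (Set.Ici 0))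
    (hg_lip : ∀ k : ℕ, 1 ≤ k → k ≤ N - 1 → ∃ L : NNReal, LipschitzOnWith L (g k) (Set.Ici 0))
    (hσ_nonneg : ∀ (k : ℕ) (x : ℝ), 0 ≤ x → 0 ≤ σ k x)
    (hf_nonneg : ∀ (k : ℕ) (x : ℝ), 0 ≤ x → 0 ≤ f k x)
    (hg_nonneg : ∀ (k : ℕ) (x : ℝ), 0 ≤ x → 0 ≤ g k x)
    (F : (Fin (N - 1) → ℝ) → ℝ)
    (hF_smooth : ContDiff ℝ (⊤ : ℕ∞) F) (hF_supp : HasCompactSupport F)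
    (hF_bdry : ∀ (y : Fin (N - 1) → ℝ) (k : Fin (N - 1)),
      y k = 0 → fderiv ℝ F y (Pi.single k 1) = 0) :
    ∀ ε : ℝ, 0 < ε → ∀ᶠ n : ℕ in atTop,
      ∀ y : Fin (N - 1) → ℝ, (∀ i, ∃ m : ℕ, y i = (m : ℝ) / Real.sqrt n) →
        |genAn (N - 1) n α σ f g F y - genA (N - 1) α σ f g F y| ≤ ε := by
  intro ε hε
  have hF : TF F := ⟨hF_smooth, hF_supp⟩
  obtain ⟨C, B, hC, H⟩ := Good.sum (m := N - 1) (Finset.Icc 1 (N - 1))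
    (q := fun k => errT (N - 1) α σ f g F k) (fun k hk => by
      have hk := Finset.mem_Icc.1 hk
      exact good_err (N - 1) α σ f g F hF k hk (hσ_lip k hk.1 hk.2) (hf_lip k hk.1 hk.2)
        (hg_lip k hk.1 hk.2) hF_bdry)
  have hlim : Tendsto (fun n : ℕ => C * (Real.sqrt n)⁻¹) atTop (nhds (C * 0)) :=
    ((Real.tendsto_sqrt_atTop.comp tendsto_natCast_atTop_atTop).inv_tendsto_atTop).const_mul C
  rw [mul_zero] at hlim
  filter_upwards [hlim.eventually_le_const hε, eventually_ge_atTop 1] with n hn h1 y hy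
  rw [gen_diff]
  exact (H n h1 y hy).1.trans hn
end
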